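/- Let A be an Artin algebra, T a tilting A-module of projective dimension n, and B = End_A(T). Then |ed(A) − ed(B)| ≤ n. -/

import Mathlib

universe u

open CategoryTheory

namespace Paper

variable (A : Type u) [Ring A]

/-- `X` belongs to `add 𝒮`: it is a direct summand of a finite direct sum of members of `𝒮`. -/
def memAdd (S : Set (ModuleCat.{u} A)) (X : ModuleCat.{u} A) : Prop :=
  ∃ (n : ℕ) (M : Fin n → ModuleCat.{u} A) (Y : ModuleCat.{u} A),
    (∀ i, M i ∈ S) ∧ Nonempty ((X × Y) ≃ₗ[A] ((i : Fin n) → M i))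

/-- `add T` for a single module `T`. -/
def addOf (T : ModuleCat.{u} A) : Set (ModuleCat.{u} A) :=
  {X | memAdd A {T} X}

/-- `0 → X → Y → Z → 0` is a short exact sequence. -/
def IsSES {X Y Z : ModuleCat.{u} A} (f : X →ₗ[A] Y) (g : Y →ₗ[A] Z) : Prop :=
  Function.Injective f ∧ Function.Surjective g ∧ LinearMap.range f = LinearMap.ker g

/-- The extension product `𝒮 • 𝒯` of two classes of modules. -/
def bullet (S T : Set (ModuleCat.{u} A)) : Set (ModuleCat.{u} A) :=
  {X | memAdd A {W | Module.Finite A W ∧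
    ∃ (T₁ T₂ : ModuleCat.{u} A) (f : T₁ →ₗ[A] W) (g : W →ₗ[A] T₂),
      T₁ ∈ S ∧ T₂ ∈ T ∧ IsSES A f g} X}

/-- `[T]ₙ`. -/
def bracket (T : ModuleCat.{u} A) : ℕ → Set (ModuleCat.{u} A)
  | 0 => {X | Subsingleton X}
  | 1 => addOf A T
  | (n+2) => bullet A (addOf A T) (bracket T (n+1))

/-- The extension dimension of `A`. -/
noncomputable def extDim : ℕ∞ :=
  sInf {d : ℕ∞ | ∃ n : ℕ, d = n ∧ ∃ T : ModuleCat.{u} A, Module.Finite A T ∧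
    ∀ X : ModuleCat.{u} A, Module.Finite A X → X ∈ bracket A T (n + 1)}

/-- There is an exact sequence `0 → M_n → ⋯ → M_0 → X → 0` with all `M_i ∈ add M`. -/
def ResLen (M : ModuleCat.{u} A) : ModuleCat.{u} A → ℕ → Prop
  | X, 0 => X ∈ addOf A M
  | X, (n+1) => ∃ (M₀ : ModuleCat.{u} A) (g : M₀ →ₗ[A] X),
      M₀ ∈ addOf A M ∧ Function.Surjective g ∧
        ResLen M (ModuleCat.of A (LinearMap.ker g)) n

/-- `M`-wrd(X) ≤ n : there is an exact sequence `0 → M_n → ⋯ → M_0 → X ⊕ Y → 0`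
with all `M_i ∈ add M`. -/
def wrdLE (M X : ModuleCat.{u} A) (n : ℕ) : Prop :=
  ∃ Y : ModuleCat.{u} A, Module.Finite A Y ∧ ResLen A M (ModuleCat.of A (X × Y)) n

/-- The weak `M`-resolution dimension of `X`. -/
noncomputable def wrdMod (M X : ModuleCat.{u} A) : ℕ∞ :=
  sInf {d : ℕ∞ | ∃ n : ℕ, d = n ∧ wrdLE A M X n}

/-- The weak `M`-resolution dimension of the algebra `A`. -/
noncomputable def wrdAlg (M : ModuleCat.{u} A) : ℕ∞ :=
  sSup {d : ℕ∞ | ∃ X : ModuleCat.{u} A, Module.Finite A X ∧ d = wrdMod A M X}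

/-- The weak resolution dimension of `A`. -/
noncomputable def wrd : ℕ∞ :=
  sInf {d : ℕ∞ | ∃ M : ModuleCat.{u} A, Module.Finite A M ∧ d = wrdAlg A M}

end Paper

/-- There is an exact sequence `0 → P_n → ⋯ → P_0 → X → 0` with all `P_i`
finitely generated projective, i.e. `pd X ≤ n`. -/
def Paper.ProjRes (A : Type u) [Ring A] : ModuleCat.{u} A → ℕ → Prop
  | X, 0 => Module.Projective A X
  | X, (n+1) => ∃ (P₀ : ModuleCat.{u} A) (g : P₀ →ₗ[A] X),
      Module.Projective A P₀ ∧ Module.Finite A P₀ ∧ Function.Surjective g ∧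
        Paper.ProjRes A (ModuleCat.of A (LinearMap.ker g)) n

/-- There is an exact sequence `0 → X → T_0 → ⋯ → T_n → 0` with all
`T_i ∈ add T`. -/
def Paper.CoresBy (A : Type u) [Ring A] (T : ModuleCat.{u} A) :
    ModuleCat.{u} A → ℕ → Prop
  | X, 0 => X ∈ Paper.addOf A T
  | X, (n+1) => ∃ (T₀ : ModuleCat.{u} A) (ι : X →ₗ[A] T₀),
      T₀ ∈ Paper.addOf A T ∧ Function.Injective ι ∧
        Paper.CoresBy A T (ModuleCat.of A (T₀ ⧸ LinearMap.range ι)) n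

namespace Paper

section Duality

theorem exists_injective_essential {R : Type u} [Ring R] (I : Type u) [AddCommGroup I] [Module R I]
    [Module.Injective R I] (S : Submodule R I) :
    ∃ E : Submodule R I, S ≤ E ∧ (∀ N ≤ E, N ⊓ S = ⊥ → N = ⊥) ∧ Module.Injective R E := by
  obtain ⟨E, hSE, hE⟩ := zorn_le_nonempty₀
    {E : Submodule R I | S ≤ E ∧ ∀ N ≤ E, N ⊓ S = ⊥ → N = ⊥} (by
      intro c hc hch y hy
      refine ⟨sSup c, ⟨(hc hy).1.trans (le_sSup hy), ?_⟩, fun z hz ↦ le_sSup hz⟩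
      intro N hN hNS
      refine (Submodule.eq_bot_iff _).2 fun x hx ↦ ?_
      obtain ⟨E, hEc, hxE⟩ := (Submodule.mem_sSup_of_directed ⟨y, hy⟩ hch.directedOn).1 (hN hx)
      have hxN : Submodule.span R {x} ≤ N := by simpa using hx
      have := (hc hEc).2 (Submodule.span R {x}) (by simpa using hxE)
        (le_bot_iff.1 ((inf_le_inf_right S hxN).trans hNS.le))
      simpa using this)
    S ⟨le_rfl, fun N hN h ↦ by rwa [inf_eq_left.2 hN] at h⟩
  obtain ⟨N, -, hN⟩ := zorn_le_nonempty₀ {N : Submodule R I | N ⊓ E = ⊥} (by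
      intro c hc hch y hy
      refine ⟨sSup c, ?_, fun z hz ↦ le_sSup hz⟩
      refine (Submodule.eq_bot_iff _).2 fun x hx ↦ ?_
      obtain ⟨K, hKc, hxK⟩ := (Submodule.mem_sSup_of_directed ⟨y, hy⟩ hch.directedOn).1 hx.1
      have : x ∈ K ⊓ E := ⟨hxK, hx.2⟩
      rwa [show K ⊓ E = ⊥ from hc hKc] at this)
    ⊥ (by simp)
  have hNE : N ⊓ E = ⊥ := hN.prop
  have hinj : Function.Injective (N.mkQ ∘ₗ E.subtype) := by
    rw [injective_iff_map_eq_zero]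
    intro e he
    have : (e : I) ∈ N ⊓ E := ⟨by simpa using he, e.2⟩
    rw [hNE] at this
    simpa using this
  obtain ⟨g, hg⟩ := Module.Injective.out (N.mkQ ∘ₗ E.subtype) hinj E.subtype
  have key : ∀ K : Submodule R I, N ≤ K → K ⊓ E = ⊥ → K = N := fun K hK hKE ↦
    le_antisymm (hN.le_of_ge hKE hK) hK
  have hrange : LinearMap.range g ≤ E := by
    refine hE.le_of_ge ⟨hE.prop.1.trans ?_, ?_⟩ ?_
    · intro e he
      exact ⟨_, hg ⟨e, he⟩⟩
    · intro L hL hLS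
      have hLE : L ⊓ E = ⊥ := hE.prop.2 _ inf_le_right (by
        rw [inf_assoc, inf_eq_right.2 hE.prop.1, hLS])
      have hK := key (L.comap (g ∘ₗ N.mkQ)) (fun x hx ↦ by
        have : N.mkQ x = 0 := by simpa using hx
        simp [Submodule.mem_comap, -Submodule.mkQ_apply, this]) (by
        refine (Submodule.eq_bot_iff _).2 fun e he ↦ ?_
        have h1 : g (N.mkQ e) ∈ L := he.1
        have h2 : g (N.mkQ e) = e := hg ⟨e, he.2⟩
        rw [h2] at h1
        have : e ∈ L ⊓ E := ⟨h1, he.2⟩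
        rwa [hLE] at this)
      refine (Submodule.eq_bot_iff _).2 fun l hl ↦ ?_
      obtain ⟨y, rfl⟩ := hL hl
      obtain ⟨x, rfl⟩ := N.mkQ_surjective y
      have : x ∈ L.comap (g ∘ₗ N.mkQ) := hl
      rw [hK] at this
      have : N.mkQ x = 0 := by simpa using this
      rw [this, map_zero]
    · intro e he
      exact ⟨_, hg ⟨e, he⟩⟩
  refine ⟨E, hSE, hE.prop.2, ⟨fun X Y _ _ _ _ f hf h ↦ ?_⟩⟩
  obtain ⟨h', hh'⟩ := Module.Injective.out f hf (E.subtype ∘ₗ h)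
  refine ⟨(g.codRestrict E fun x ↦ hrange ⟨x, rfl⟩) ∘ₗ N.mkQ ∘ₗ h', fun x ↦ Subtype.ext ?_⟩
  have := hg (h x)
  simpa [hh'] using this

/-- An injective module over a commutative ring which dualizes finite modules. -/
def IsDualizing (k : Type u) [CommRing k] (E : Type u) [AddCommGroup E] [Module k E] : Prop :=
  Module.Injective k E ∧ ∀ (M : Type u) [AddCommGroup M] [Module k M] [Module.Finite k M],
    Module.Finite k (M →ₗ[k] E) ∧
      Function.Bijective (LinearMap.applyₗ : M →ₗ[k] (M →ₗ[k] E) →ₗ[k] E)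

open scoped Classical in
theorem exists_isDualizing (k : Type u) [CommRing k] [IsArtinianRing k] :
    ∃ (E : Type u) (_ : AddCommGroup E) (_ : Module k E), IsDualizing k E := by
  let S₀ : Type u := (m : MaximalSpectrum k) → k ⧸ m.asIdeal
  obtain ⟨⟨J, hJ, ι, hι⟩⟩ := EnoughInjectives.presentation (ModuleCat.of k S₀)
  have hJ' : Module.Injective k J := Module.injective_module_of_injective_object k J
  have hι' : Function.Injective ι.hom := (ModuleCat.mono_iff_injective ι).1 hι
  obtain ⟨E, hSE, hess, hE⟩ := exists_injective_essential J (LinearMap.range ι.hom)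
  have hlen1 : ∀ (Q : Type u) [AddCommGroup Q] [Module k Q] [IsSimpleModule k Q],
      Module.length k (Q →ₗ[k] E) ≤ 1 := by
    intro Q _ _ _
    obtain ⟨m, hm, ⟨e⟩⟩ := isSimpleModule_iff_quot_maximal.1 ‹IsSimpleModule k Q›
    have hr : ∀ f : Q →ₗ[k] E, ∃ s : S₀, ι.hom s = (f (e.symm 1) : J) := by
      intro f
      by_cases hf : f = 0
      · exact ⟨0, by simp [hf]⟩
      have hfi : Function.Injective f := LinearMap.injective_of_ne_zero hf
      have hN : (LinearMap.range (E.subtype ∘ₗ f)) ⊓ LinearMap.range ι.hom ≠ ⊥ := by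
        intro h
        have h0 := hess _ (by rintro _ ⟨x, rfl⟩; exact (f x).2) h
        rw [LinearMap.range_eq_bot] at h0
        apply hf
        ext x
        exact congr($h0 x)
      obtain ⟨_, ⟨⟨x, rfl⟩, s, hs⟩, hx⟩ := Submodule.exists_mem_ne_zero_of_ne_bot hN
      have hx0 : x ≠ 0 := by rintro rfl; simp at hx
      have : e.symm 1 ∈ Submodule.span k {x} := by
        rw [IsSimpleModule.span_singleton_eq_top k hx0]; trivial
      obtain ⟨a, ha⟩ := Submodule.mem_span_singleton.1 this
      refine ⟨a • s, ?_⟩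
      rw [← ha, map_smul, hs, map_smul]; rfl
    choose s hs using hr
    let q : (Q →ₗ[k] E) →ₗ[k] S₀ :=
      { toFun := s
        map_add' := fun f g ↦ hι' (by simp [hs])
        map_smul' := fun a f ↦ hι' (by rw [map_smul, hs, hs]; rfl) }
    let q' : (Q →ₗ[k] E) →ₗ[k] (k ⧸ m) := LinearMap.proj (⟨m, hm⟩ : MaximalSpectrum k) ∘ₗ q
    have hq' : Function.Injective q' := by
      rw [injective_iff_map_eq_zero]
      intro f hf
      have hsm : ∀ a ∈ m, a • s f = 0 := by
        intro a ha
        apply hι'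
        rw [map_smul, hs, map_zero]
        have : a • e.symm 1 = 0 := by
          rw [← map_smul]
          have : a • (1 : k ⧸ m) = 0 := by
            rw [Algebra.smul_def, mul_one]; exact Ideal.Quotient.eq_zero_iff_mem.2 ha
          rw [this, map_zero]
        have h2 : a • f (e.symm 1) = 0 := by rw [← map_smul, this, map_zero]
        exact congrArg Subtype.val h2
      have hs0 : s f = 0 := by
        funext m'
        by_cases h : m' = ⟨m, hm⟩
        · subst h; exact hf
        · have hsup : m ⊔ m'.asIdeal = ⊤ :=
            hm.coprime_of_ne m'.isMaximal (fun h' ↦ h (MaximalSpectrum.ext h'.symm))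
          obtain ⟨a, ha, b, hb, hab⟩ := Submodule.mem_sup.1
            (show (1 : k) ∈ m ⊔ m'.asIdeal by rw [hsup]; trivial)
          have h1 : a • s f m' = 0 := congrFun (hsm a ha) m'
          have h2 : b • s f m' = 0 := by
            obtain ⟨y, hy⟩ := Ideal.Quotient.mk_surjective (s f m')
            rw [← hy, Algebra.smul_def]
            have : algebraMap k (k ⧸ m'.asIdeal) b = 0 := Ideal.Quotient.eq_zero_iff_mem.2 hb
            rw [this, zero_mul]
          have : (a + b) • s f m' = 0 := by rw [add_smul, h1, h2, add_zero]
          rw [hab, one_smul] at this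
          exact this
      have h0 : f (e.symm 1) = 0 := by
        apply Subtype.ext
        rw [← hs f, hs0, map_zero]; rfl
      ext x
      have hsp : x ∈ Submodule.span k {e.symm 1} := by
        have hne : e.symm 1 ≠ 0 := by
          have : Nontrivial (k ⧸ m) := Ideal.Quotient.nontrivial_iff.2 hm.ne_top
          simp
        rw [IsSimpleModule.span_singleton_eq_top k hne]; trivial
      obtain ⟨a, rfl⟩ := Submodule.mem_span_singleton.1 hsp
      simp [h0]
    have := Module.length_le_of_injective q' hq'
    have hsimple : IsSimpleModule k (k ⧸ m) := isSimpleModule_iff_quot_maximal.2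
      ⟨m, hm, ⟨LinearEquiv.refl _ _⟩⟩
    rwa [Module.length_eq_one_iff.2 hsimple] at this
  have hlen : ∀ (M : Type u) [AddCommGroup M] [Module k M], IsFiniteLength k M →
      Module.length k (M →ₗ[k] E) ≤ Module.length k M := by
    intro M _ _ h
    induction h with
    | of_subsingleton =>
      rw [Module.length_eq_zero, Module.length_eq_zero]
    | @of_simple_quotient M _ _ N _ _ ih =>
      have h1 : Module.length k (M →ₗ[k] E)
          = Module.length k ((M ⧸ N) →ₗ[k] E) + Module.length k (N →ₗ[k] E) :=
        Module.length_eq_add_of_exact (LinearMap.lcomp k E N.mkQ) (LinearMap.lcomp k E N.subtype)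
          (LinearMap.lcomp_injective_of_surjective _ N.mkQ_surjective)
          (fun f ↦ by
            obtain ⟨g, hg⟩ := Module.Injective.out N.subtype N.subtype_injective f
            exact ⟨g, LinearMap.ext hg⟩)
          (by
            intro f
            constructor
            · intro hf
              exact ⟨N.liftQ f (fun x hx ↦ congr($hf ⟨x, hx⟩)), by ext; rfl⟩
            · rintro ⟨g, rfl⟩
              ext x
              have : N.mkQ x = 0 := by simp
              simp [-Submodule.mkQ_apply, this])
      have h2 : Module.length k M = Module.length k N + Module.length k (M ⧸ N) :=
        Module.length_eq_add_of_exact N.subtype N.mkQ N.subtype_injective N.mkQ_surjective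
          (LinearMap.exact_subtype_mkQ N)
      rw [h1, h2, add_comm]
      refine add_le_add ih ?_
      rw [Module.length_eq_one_iff.2 ‹IsSimpleModule k (M ⧸ N)›]
      exact hlen1 _
  refine ⟨E, inferInstance, inferInstance, hE, fun M _ _ _ ↦ ?_⟩
  have hM : IsFiniteLength k M :=
    isFiniteLength_iff_isNoetherian_isArtinian.2 ⟨inferInstance, inferInstance⟩
  have hM1 : IsFiniteLength k (M →ₗ[k] E) := Module.length_ne_top_iff.1
    (ne_top_of_le_ne_top (Module.length_ne_top_iff.2 hM) (hlen M hM))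
  have := (isFiniteLength_iff_isNoetherian_isArtinian.1 hM1).1
  refine ⟨inferInstance, ?_⟩
  have hinj : Function.Injective (LinearMap.applyₗ : M →ₗ[k] (M →ₗ[k] E) →ₗ[k] E) := by
    rw [injective_iff_map_eq_zero]
    intro x hx
    by_contra hx0
    have hne : Ideal.torsionOf k M x ≠ ⊤ := by simpa using hx0
    obtain ⟨m, hm, hle⟩ := Ideal.exists_le_maximal _ hne
    let c : Submodule.span k {x} →ₗ[k] (k ⧸ m) :=
      (Submodule.mapQ (Ideal.torsionOf k M x) m LinearMap.id hle) ∘ₗ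
        (Ideal.quotTorsionOfEquivSpanSingleton k M x).symm.toLinearMap
    have hc : c ⟨x, Submodule.mem_span_singleton_self x⟩ = 1 := by
      have : (Ideal.quotTorsionOfEquivSpanSingleton k M x).symm
          ⟨x, Submodule.mem_span_singleton_self x⟩ = Submodule.Quotient.mk 1 := by
        rw [LinearEquiv.symm_apply_eq, Ideal.quotTorsionOfEquivSpanSingleton_apply_mk]
        ext
        simp
      simp only [c, LinearMap.comp_apply, LinearEquiv.coe_coe, this]
      rfl
    let d : Submodule.span k {x} →ₗ[k] E :=
      (Submodule.inclusion hSE ∘ₗ ι.hom.rangeRestrict) ∘ₗ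
        (LinearMap.single k (fun m : MaximalSpectrum k ↦ k ⧸ m.asIdeal) ⟨m, hm⟩) ∘ₗ c
    obtain ⟨f, hf⟩ := Module.Injective.out (Submodule.span k {x}).subtype
      (Submodule.subtype_injective _) d
    have h1 := hf ⟨x, Submodule.mem_span_singleton_self x⟩
    have h2 : f x = 0 := congr($hx f)
    have h3 : d ⟨x, Submodule.mem_span_singleton_self x⟩ = 0 := by rw [← h1]; exact h2
    have h4 : ι.hom (Pi.single (⟨m, hm⟩ : MaximalSpectrum k) (1 : k ⧸ m)) = 0 := by
      have := congrArg Subtype.val h3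
      simp only [d, LinearMap.comp_apply, hc] at this
      exact this
    have h5 : (Pi.single (⟨m, hm⟩ : MaximalSpectrum k) (1 : k ⧸ m) : S₀) = 0 :=
      hι' (h4.trans (map_zero _).symm)
    have : Nontrivial (k ⧸ m) := Ideal.Quotient.nontrivial_iff.2 hm.ne_top
    have h6 := congrFun h5 ⟨m, hm⟩
    rw [Pi.single_eq_same] at h6
    exact one_ne_zero h6
  refine ⟨hinj, ?_⟩
  rw [← LinearMap.range_eq_top]
  by_contra hne
  have hM2 := hlen _ hM1
  have hfl : IsFiniteLength k ((M →ₗ[k] E) →ₗ[k] E) := Module.length_ne_top_iff.1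
    (ne_top_of_le_ne_top (Module.length_ne_top_iff.2 hM1) hM2)
  obtain ⟨_, _⟩ := isFiniteLength_iff_isNoetherian_isArtinian.1 hfl
  have h1 := Submodule.length_lt hne
  rw [← (LinearEquiv.ofInjective _ hinj).length_eq] at h1
  exact absurd (h1.trans_le (hM2.trans (hlen M hM))) (lt_irrefl _)

end Duality

section Additive

variable {A : Type u} [Ring A]

/-- `X` is a direct summand of `Y`. -/
def IsRetract (X Y : ModuleCat.{u} A) : Prop :=
  ∃ (s : X →ₗ[A] Y) (r : Y →ₗ[A] X), r ∘ₗ s = LinearMap.id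

theorem IsRetract.of_equiv {X Y : ModuleCat.{u} A} (e : X ≃ₗ[A] Y) : IsRetract X Y :=
  ⟨e.toLinearMap, e.symm.toLinearMap, by ext; simp⟩

theorem IsRetract.refl (X : ModuleCat.{u} A) : IsRetract X X := .of_equiv (.refl A X)

theorem IsRetract.trans {X Y Z : ModuleCat.{u} A} (h : IsRetract X Y) (h' : IsRetract Y Z) :
    IsRetract X Z := by
  obtain ⟨s, r, hrs⟩ := h
  obtain ⟨s', r', hrs'⟩ := h'
  refine ⟨s' ∘ₗ s, r ∘ₗ r', LinearMap.ext fun x ↦ ?_⟩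
  have h1 := congr($hrs' (s x))
  have h2 := congr($hrs x)
  simp only [LinearMap.comp_apply, LinearMap.id_apply] at h1 h2 ⊢
  rw [h1, h2]

theorem IsRetract.fst (X Y : ModuleCat.{u} A) : IsRetract X (ModuleCat.of A (X × Y)) :=
  ⟨LinearMap.inl A X Y, LinearMap.fst A X Y, by ext; rfl⟩

theorem IsRetract.snd (X Y : ModuleCat.{u} A) : IsRetract Y (ModuleCat.of A (X × Y)) :=
  ⟨LinearMap.inr A X Y, LinearMap.snd A X Y, by ext; rfl⟩

theorem IsRetract.prod {X Y X' Y' : ModuleCat.{u} A} (h : IsRetract X Y) (h' : IsRetract X' Y') :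
    IsRetract (ModuleCat.of A (X × X')) (ModuleCat.of A (Y × Y')) := by
  obtain ⟨s, r, hrs⟩ := h
  obtain ⟨s', r', hrs'⟩ := h'
  refine ⟨s.prodMap s', r.prodMap r', ?_⟩
  rw [LinearMap.prodMap_comp, hrs, hrs']
  rfl

theorem IsRetract.finite {X Y : ModuleCat.{u} A} (h : IsRetract X Y) [Module.Finite A Y] :
    Module.Finite A X := by
  obtain ⟨s, r, hrs⟩ := h
  exact Module.Finite.of_surjective r fun x ↦ ⟨s x, congr($hrs x)⟩

theorem IsRetract.exists_compl {X Y : ModuleCat.{u} A} (h : IsRetract X Y) :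
    ∃ X' : ModuleCat.{u} A, Nonempty ((X × X') ≃ₗ[A] Y) := by
  obtain ⟨s, r, hrs⟩ := h
  have hrs' : ∀ x, r (s x) = x := fun x ↦ congr($hrs x)
  refine ⟨ModuleCat.of A (LinearMap.ker r), ⟨LinearEquiv.ofLinearMap
    (s.coprod (LinearMap.ker r).subtype)
    (r.prod ((LinearMap.id - s ∘ₗ r).codRestrict _ fun y ↦ by simp [hrs'])) ?_ ?_⟩⟩
  · ext y
    simp
  · refine LinearMap.ext fun ⟨x, y⟩ ↦ ?_
    have hy : r y = 0 := y.2
    ext <;> simp [hrs', hy]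

theorem memAdd_of_retract {S : Set (ModuleCat.{u} A)} {X : ModuleCat.{u} A} {n : ℕ}
    {M : Fin n → ModuleCat.{u} A} (hM : ∀ i, M i ∈ S)
    (h : IsRetract X (ModuleCat.of A ((i : Fin n) → M i))) : memAdd A S X := by
  obtain ⟨X', ⟨e⟩⟩ := h.exists_compl
  exact ⟨n, M, X', hM, ⟨e⟩⟩

theorem memAdd_iff {S : Set (ModuleCat.{u} A)} {X : ModuleCat.{u} A} :
    memAdd A S X ↔ ∃ (n : ℕ) (M : Fin n → ModuleCat.{u} A), (∀ i, M i ∈ S) ∧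
      IsRetract X (ModuleCat.of A ((i : Fin n) → M i)) :=
  ⟨fun ⟨n, M, Y, hM, ⟨e⟩⟩ ↦ ⟨n, M, hM, (IsRetract.fst X Y).trans (.of_equiv e)⟩,
    fun ⟨_, _, hM, h⟩ ↦ memAdd_of_retract hM h⟩

theorem memAdd.retract {S : Set (ModuleCat.{u} A)} {X Y : ModuleCat.{u} A} (hY : memAdd A S Y)
    (h : IsRetract X Y) : memAdd A S X := by
  obtain ⟨n, M, hM, h'⟩ := memAdd_iff.1 hY
  exact memAdd_of_retract hM (h.trans h')

theorem memAdd.of_mem {S : Set (ModuleCat.{u} A)} {X : ModuleCat.{u} A} (hX : X ∈ S) :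
    memAdd A S X :=
  memAdd_of_retract (n := 1) (M := fun _ ↦ X) (fun _ ↦ hX)
    (.of_equiv (LinearEquiv.funUnique (Fin 1) A X).symm)

theorem memAdd.of_subsingleton {S : Set (ModuleCat.{u} A)} {X : ModuleCat.{u} A}
    [Subsingleton X] : memAdd A S X :=
  memAdd_of_retract (n := 0) (M := fun _ ↦ X) (fun i ↦ i.elim0)
    ⟨0, 0, Subsingleton.elim _ _⟩

theorem memAdd.prod {S : Set (ModuleCat.{u} A)} {X Y : ModuleCat.{u} A} (hX : memAdd A S X)
    (hY : memAdd A S Y) : memAdd A S (ModuleCat.of A (X × Y)) := by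
  obtain ⟨n, M, hM, h⟩ := memAdd_iff.1 hX
  obtain ⟨n', M', hM', h'⟩ := memAdd_iff.1 hY
  refine memAdd_of_retract (n := n + n') (M := Fin.append M M') (fun i ↦ ?_)
    ((h.prod h').trans ⟨?_, ?_, ?_⟩)
  · induction i using Fin.addCases <;> simp [hM, hM']
  · exact LinearMap.pi fun i ↦ Fin.addCases
      (motive := fun i ↦ (((i : Fin n) → M i) × ((i : Fin n') → M' i)) →ₗ[A]
        (Fin.append M M' i : ModuleCat.{u} A))
      (fun i ↦ (LinearEquiv.cast (R := A) (M := fun X : ModuleCat.{u} A ↦ X)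
        (Fin.append_left M M' i).symm).toLinearMap ∘ₗ LinearMap.proj i ∘ₗ LinearMap.fst A _ _)
      (fun i ↦ (LinearEquiv.cast (R := A) (M := fun X : ModuleCat.{u} A ↦ X)
        (Fin.append_right M M' i).symm).toLinearMap ∘ₗ LinearMap.proj i ∘ₗ LinearMap.snd A _ _) i
  · exact LinearMap.prod
      (LinearMap.pi fun i ↦ (LinearEquiv.cast (R := A) (M := fun X : ModuleCat.{u} A ↦ X)
        (Fin.append_left M M' i)).toLinearMap ∘ₗ LinearMap.proj (Fin.castAdd n' i))
      (LinearMap.pi fun i ↦ (LinearEquiv.cast (R := A) (M := fun X : ModuleCat.{u} A ↦ X)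
        (Fin.append_right M M' i)).toLinearMap ∘ₗ LinearMap.proj (Fin.natAdd n i))
  · refine LinearMap.ext fun ⟨x, y⟩ ↦ ?_
    ext i <;> simp

theorem pi_mem {Q : Set (ModuleCat.{u} A)}
    (iso : ∀ {X Y : ModuleCat.{u} A}, (X ≃ₗ[A] Y) → X ∈ Q → Y ∈ Q)
    (zero : ∀ X : ModuleCat.{u} A, Subsingleton X → X ∈ Q)
    (prod : ∀ X Y : ModuleCat.{u} A, X ∈ Q → Y ∈ Q → ModuleCat.of A (X × Y) ∈ Q) :
    ∀ {n : ℕ} {M : Fin n → ModuleCat.{u} A}, (∀ i, M i ∈ Q) →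
      ModuleCat.of A ((i : Fin n) → M i) ∈ Q
  | 0, M, _ => zero _ (inferInstanceAs (Subsingleton ((i : Fin 0) → M i)))
  | n + 1, M, hM => iso (X := ModuleCat.of A (M 0 × ((i : Fin n) → M i.succ)))
      (Fin.consLinearEquiv A (fun i ↦ M i))
      (prod _ (ModuleCat.of A ((i : Fin n) → M i.succ)) (hM 0)
        (pi_mem iso zero prod fun i ↦ hM i.succ))

theorem memAdd.pi {S : Set (ModuleCat.{u} A)} {n : ℕ} {M : Fin n → ModuleCat.{u} A}
    (hM : ∀ i, memAdd A S (M i)) : memAdd A S (ModuleCat.of A ((i : Fin n) → M i)) :=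
  pi_mem (Q := {X | memAdd A S X}) (fun e h ↦ h.retract (.of_equiv e.symm))
    (fun _ _ ↦ memAdd.of_subsingleton) (fun _ _ ↦ memAdd.prod) hM

theorem memAdd.mono {S S' : Set (ModuleCat.{u} A)} (hS : ∀ X ∈ S, memAdd A S' X)
    {X : ModuleCat.{u} A} (hX : memAdd A S X) : memAdd A S' X := by
  obtain ⟨n, M, hM, h⟩ := memAdd_iff.1 hX
  exact (memAdd.pi fun i ↦ hS _ (hM i)).retract h

theorem memAdd.induction {S Q : Set (ModuleCat.{u} A)} (hS : S ⊆ Q)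
    (retract : ∀ {X Y : ModuleCat.{u} A}, IsRetract X Y → Y ∈ Q → X ∈ Q)
    (zero : ∀ X : ModuleCat.{u} A, Subsingleton X → X ∈ Q)
    (prod : ∀ X Y : ModuleCat.{u} A, X ∈ Q → Y ∈ Q → ModuleCat.of A (X × Y) ∈ Q)
    {X : ModuleCat.{u} A} (hX : memAdd A S X) : X ∈ Q := by
  obtain ⟨n, M, hM, h⟩ := memAdd_iff.1 hX
  exact retract h (pi_mem (fun e ↦ retract (.of_equiv e.symm)) zero prod fun i ↦ hS (hM i))

theorem mem_addOf_iff {T X : ModuleCat.{u} A} :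
    X ∈ addOf A T ↔ ∃ n : ℕ, IsRetract X (ModuleCat.of A (Fin n → T)) := by
  refine memAdd_iff.trans ⟨?_, fun ⟨n, h⟩ ↦ ⟨n, fun _ ↦ T, fun _ ↦ rfl, h⟩⟩
  rintro ⟨n, M, hM, h⟩
  obtain rfl : M = fun _ ↦ T := funext hM
  exact ⟨n, h⟩

theorem addOf_self (T : ModuleCat.{u} A) : T ∈ addOf A T := memAdd.of_mem rfl

theorem addOf_pi (T : ModuleCat.{u} A) (n : ℕ) : ModuleCat.of A (Fin n → T) ∈ addOf A T :=
  mem_addOf_iff.2 ⟨n, .refl _⟩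

theorem finite_of_mem_addOf {T X : ModuleCat.{u} A} [Module.Finite A T] (hX : X ∈ addOf A T) :
    Module.Finite A X := by
  obtain ⟨n, h⟩ := mem_addOf_iff.1 hX
  have : Module.Finite A (ModuleCat.of A (Fin n → T)) :=
    inferInstanceAs (Module.Finite A (Fin n → T))
  exact h.finite

end Additive

section ShortExact

variable {A : Type u} [Ring A] {X Y Z : ModuleCat.{u} A} {f : X →ₗ[A] Y} {g : Y →ₗ[A] Z}

theorem IsSES.comp_apply (h : IsSES A f g) (x : X) : g (f x) = 0 := by
  have : f x ∈ LinearMap.ker g := h.2.2 ▸ ⟨x, rfl⟩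
  exact this

theorem IsSES.exists_preimage (h : IsSES A f g) {y : Y} (hy : g y = 0) : ∃ x, f x = y := by
  have : y ∈ LinearMap.range f := by rw [h.2.2]; exact hy
  exact this

theorem IsSES.mk' (hf : Function.Injective f) (hg : Function.Surjective g)
    (h₁ : ∀ x, g (f x) = 0) (h₂ : ∀ y, g y = 0 → ∃ x, f x = y) : IsSES A f g :=
  ⟨hf, hg, le_antisymm (by rintro _ ⟨x, rfl⟩; exact h₁ x) h₂⟩

theorem isSES_of_surjective (hg : Function.Surjective g) :
    IsSES A (X := ModuleCat.of A (LinearMap.ker g)) (LinearMap.ker g).subtype g :=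
  ⟨Submodule.subtype_injective _, hg, Submodule.range_subtype _⟩

theorem isSES_of_injective (hf : Function.Injective f) :
    IsSES A (Z := ModuleCat.of A (Y ⧸ LinearMap.range f)) f (LinearMap.range f).mkQ :=
  ⟨hf, Submodule.mkQ_surjective _, (Submodule.ker_mkQ _).symm⟩

theorem isSES_split (X Y : ModuleCat.{u} A) :
    IsSES A (Y := ModuleCat.of A (X × Y)) (LinearMap.inl A X Y) (LinearMap.snd A X Y) :=
  .mk' LinearMap.inl_injective LinearMap.snd_surjective (fun _ ↦ rfl)
    fun ⟨x, y⟩ hy ↦ ⟨x, by rw [show y = 0 from hy]; rfl⟩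

/-- Linear maps out of the last term of a short exact sequence. -/
theorem IsSES.exists_desc (h : IsSES A f g) {L : ModuleCat.{u} A} (p : Y →ₗ[A] L)
    (hp : ∀ x, p (f x) = 0) : ∃ q : Z →ₗ[A] L, ∀ y, q (g y) = p y := by
  refine ⟨((LinearMap.ker g).liftQ p ?_) ∘ₗ
    (g.quotKerEquivOfSurjective h.2.1).symm.toLinearMap, fun y ↦ ?_⟩
  · intro y hy
    obtain ⟨x, rfl⟩ := h.exists_preimage hy
    exact hp x
  · have : (g.quotKerEquivOfSurjective h.2.1).symm (g y) = Submodule.Quotient.mk y := by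
      rw [LinearEquiv.symm_apply_eq]; rfl
    simp [this]

/-- Linear maps into the first term of a short exact sequence. -/
theorem IsSES.exists_lift (h : IsSES A f g) {L : ModuleCat.{u} A} (p : L →ₗ[A] Y)
    (hp : ∀ x, g (p x) = 0) : ∃ q : L →ₗ[A] X, ∀ y, f (q y) = p y := by
  choose q hq using fun y ↦ h.exists_preimage (hp y)
  exact ⟨{ toFun := q
           map_add' := fun _ _ ↦ h.1 (by simp [hq])
           map_smul' := fun _ _ ↦ h.1 (by simp [hq]) }, hq⟩

theorem IsSES.finite_mid (h : IsSES A f g) [Module.Finite A X] [Module.Finite A Z] :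
    Module.Finite A Y := by
  have : Module.Finite A (LinearMap.ker g) := by rw [← h.2.2]; infer_instance
  have := Module.Finite.equiv (g.quotKerEquivOfSurjective h.2.1).symm
  exact Module.Finite.of_submodule_quotient (LinearMap.ker g)

theorem IsSES.finite_right (h : IsSES A f g) [Module.Finite A Y] : Module.Finite A Z :=
  Module.Finite.of_surjective g h.2.1

theorem IsSES.finite_left [IsNoetherianRing A] (h : IsSES A f g) [Module.Finite A Y] :
    Module.Finite A X :=
  Module.Finite.of_injective f h.1

theorem IsSES.equiv_left (h : IsSES A f g) {X' : ModuleCat.{u} A} (e : X' ≃ₗ[A] X) :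
    IsSES A (f ∘ₗ e.toLinearMap) g :=
  .mk' (h.1.comp e.injective) h.2.1 (fun x ↦ h.comp_apply (e x)) fun y hy ↦ by
    obtain ⟨x, rfl⟩ := h.exists_preimage hy
    exact ⟨e.symm x, by simp⟩

theorem IsSES.equiv_right (h : IsSES A f g) {Z' : ModuleCat.{u} A} (e : Z ≃ₗ[A] Z') :
    IsSES A f (e.toLinearMap ∘ₗ g) :=
  .mk' h.1 (e.surjective.comp h.2.1) (fun x ↦ by simp [h.comp_apply])
    fun y hy ↦ h.exists_preimage (by simpa using hy)

theorem IsSES.prod (h : IsSES A f g) {X' Y' Z' : ModuleCat.{u} A} {f' : X' →ₗ[A] Y'}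
    {g' : Y' →ₗ[A] Z'} (h' : IsSES A f' g') :
    IsSES A (X := ModuleCat.of A (X × X')) (Y := ModuleCat.of A (Y × Y'))
      (Z := ModuleCat.of A (Z × Z')) (f.prodMap f') (g.prodMap g') :=
  .mk' (Prod.map_injective.2 ⟨h.1, h'.1⟩) (Prod.map_surjective.2 ⟨h.2.1, h'.2.1⟩)
    (fun x ↦ Prod.ext (h.comp_apply x.1) (h'.comp_apply x.2)) fun y hy ↦ by
      obtain ⟨x, hx⟩ := h.exists_preimage (y := y.1) congr(($hy).1)
      obtain ⟨x', hx'⟩ := h'.exists_preimage (y := y.2) congr(($hy).2)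
      exact ⟨(x, x'), Prod.ext hx hx'⟩

end ShortExact

section Bracket

variable {A : Type u} [Ring A]

theorem exists_bracket_eq (T : ModuleCat.{u} A) (q : ℕ) :
    ∃ S, bracket A T (q + 1) = {X | memAdd A S X} := by
  cases q
  · exact ⟨_, rfl⟩
  · exact ⟨_, rfl⟩

theorem bracket_retract {T X Y : ModuleCat.{u} A} {q : ℕ} (hY : Y ∈ bracket A T (q + 1))
    (h : IsRetract X Y) : X ∈ bracket A T (q + 1) := by
  obtain ⟨S, hS⟩ := exists_bracket_eq T q
  rw [hS] at hY ⊢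
  exact memAdd.retract hY h

theorem bracket_equiv {T X Y : ModuleCat.{u} A} {q : ℕ} (hY : Y ∈ bracket A T (q + 1))
    (e : Y ≃ₗ[A] X) : X ∈ bracket A T (q + 1) :=
  bracket_retract hY (.of_equiv e.symm)

theorem bracket_prod {T X Y : ModuleCat.{u} A} {q : ℕ} (hX : X ∈ bracket A T (q + 1))
    (hY : Y ∈ bracket A T (q + 1)) : ModuleCat.of A (X × Y) ∈ bracket A T (q + 1) := by
  obtain ⟨S, hS⟩ := exists_bracket_eq T q
  rw [hS] at hX hY ⊢
  exact memAdd.prod hX hY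

theorem bracket_of_subsingleton {T X : ModuleCat.{u} A} {q : ℕ} [Subsingleton X] :
    X ∈ bracket A T (q + 1) := by
  obtain ⟨S, hS⟩ := exists_bracket_eq T q
  rw [hS]
  exact memAdd.of_subsingleton

theorem bracket_of_ses {T X W Y : ModuleCat.{u} A} {q : ℕ} {f : X →ₗ[A] W} {g : W →ₗ[A] Y}
    (h : IsSES A f g) (hW : Module.Finite A W) (hX : X ∈ addOf A T)
    (hY : Y ∈ bracket A T (q + 1)) : W ∈ bracket A T (q + 2) :=
  memAdd.of_mem ⟨hW, X, Y, f, g, hX, hY, h⟩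

/-- A module in `[T]_{q+2}` is a summand of one extension of a module of `[T]_{q+1}`
by a module of `add T`. -/
theorem exists_ses_of_mem_bracket {T X : ModuleCat.{u} A} {q : ℕ}
    (hX : X ∈ bracket A T (q + 2)) :
    ∃ (M W Y : ModuleCat.{u} A) (f : M →ₗ[A] W) (g : W →ₗ[A] Y), IsRetract X W ∧
      Module.Finite A W ∧ M ∈ addOf A T ∧ Y ∈ bracket A T (q + 1) ∧ IsSES A f g := by
  refine memAdd.induction (Q := {X | ∃ (M W Y : ModuleCat.{u} A) (f : M →ₗ[A] W)
      (g : W →ₗ[A] Y), IsRetract X W ∧ Module.Finite A W ∧ M ∈ addOf A T ∧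
      Y ∈ bracket A T (q + 1) ∧ IsSES A f g}) ?_ ?_ ?_ ?_ hX
  · rintro W ⟨hW, M, Y, f, g, hM, hY, h⟩
    exact ⟨M, W, Y, f, g, .refl W, hW, hM, hY, h⟩
  · rintro X X' h ⟨M, W, Y, f, g, h', h''⟩
    exact ⟨M, W, Y, f, g, h.trans h', h''⟩
  · intro X _
    exact ⟨X, X, X, LinearMap.id, LinearMap.id, .refl X, inferInstance,
      memAdd.of_subsingleton, bracket_of_subsingleton,
      .mk' Function.injective_id Function.surjective_id (fun _ ↦ Subsingleton.elim _ _)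
        fun y _ ↦ ⟨y, rfl⟩⟩
  · rintro X X' ⟨M, W, Y, f, g, hX, hW, hM, hY, h⟩ ⟨M', W', Y', f', g', hX', hW', hM', hY', h'⟩
    exact ⟨_, _, _, _, _, hX.prod hX', inferInstanceAs (Module.Finite A (W × W')),
      memAdd.prod hM hM', bracket_prod hY hY', h.prod h'⟩

theorem finite_of_mem_bracket {T : ModuleCat.{u} A} [Module.Finite A T] :
    ∀ {q : ℕ} {X : ModuleCat.{u} A}, X ∈ bracket A T (q + 1) → Module.Finite A X
  | 0, _, hX => finite_of_mem_addOf hX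
  | _ + 1, _, hX => by
    obtain ⟨M, W, Y, f, g, h, hW, -⟩ := exists_ses_of_mem_bracket hX
    exact h.finite

theorem addOf_mono {T T' : ModuleCat.{u} A} (h : T ∈ addOf A T') {X : ModuleCat.{u} A}
    (hX : X ∈ addOf A T) : X ∈ addOf A T' :=
  memAdd.mono (by rintro _ rfl; exact h) hX

theorem bracket_mono {T T' : ModuleCat.{u} A} (h : T ∈ addOf A T') :
    ∀ {q : ℕ} {X : ModuleCat.{u} A}, X ∈ bracket A T (q + 1) → X ∈ bracket A T' (q + 1)
  | 0, _, hX => addOf_mono h hX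
  | q + 1, _, hX => by
    obtain ⟨M, W, Y, f, g, hr, hW, hM, hY, hs⟩ := exists_ses_of_mem_bracket hX
    exact bracket_retract (bracket_of_ses hs hW (addOf_mono h hM) (bracket_mono h hY)) hr

/-- A relation between modules over two rings which is compatible with short exact sequences
transports the filtrations of `bracket`, up to direct summands. -/
theorem bracket_transfer {C : Type u} [Ring C] {M : ModuleCat.{u} A} {N : ModuleCat.{u} C}
    [Module.Finite C N] (Rel : ModuleCat.{u} A → ModuleCat.{u} C → Prop)
    (iso : ∀ {X Y : ModuleCat.{u} A} {Z : ModuleCat.{u} C}, (X ≃ₗ[A] Y) → Rel X Z → Rel Y Z)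
    (base : ∀ r : ℕ, ∃ Z ∈ addOf C N, Rel (ModuleCat.of A (Fin r → M)) Z)
    (ses : ∀ {X W Y : ModuleCat.{u} A} {f : X →ₗ[A] W} {g : W →ₗ[A] Y} {Z₁ Z₂ : ModuleCat.{u} C},
      IsSES A f g → Rel X Z₁ → Rel Y Z₂ → ∃ (Z : ModuleCat.{u} C) (f' : Z₁ →ₗ[C] Z)
        (g' : Z →ₗ[C] Z₂), Rel W Z ∧ IsSES C f' g') :
    ∀ {q : ℕ} {X : ModuleCat.{u} A}, X ∈ bracket A M (q + 1) →
      ∃ (X' : ModuleCat.{u} A) (Z : ModuleCat.{u} C),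
        Rel (ModuleCat.of A (X × X')) Z ∧ Z ∈ bracket C N (q + 1)
  | 0, X, hX => by
    obtain ⟨r, h⟩ := mem_addOf_iff.1 hX
    obtain ⟨X', ⟨e⟩⟩ := h.exists_compl
    obtain ⟨Z, hZ, hrel⟩ := base r
    exact ⟨X', Z, iso e.symm hrel, hZ⟩
  | q + 1, X, hX => by
    obtain ⟨M₁, W, Y, f, g, hr, hW, hM, hY, hs⟩ := exists_ses_of_mem_bracket hX
    obtain ⟨X', ⟨e⟩⟩ := hr.exists_compl
    obtain ⟨r, h⟩ := mem_addOf_iff.1 hM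
    obtain ⟨M', ⟨e'⟩⟩ := h.exists_compl
    obtain ⟨Z₁, hZ₁, hrel₁⟩ := base r
    obtain ⟨Y', Z₂, hrel₂, hZ₂⟩ := bracket_transfer Rel iso base ses hY
    have hs' : IsSES A (X := ModuleCat.of A (M₁ × M')) (Z := ModuleCat.of A (Y × Y'))
        (Y := ModuleCat.of A (W × (M' × Y')))
        (f.prodMap (LinearMap.inl A M' Y')) (g.prodMap (LinearMap.snd A M' Y')) :=
      hs.prod (isSES_split M' Y')
    obtain ⟨Z, f', g', hrel, hZs⟩ := ses hs' (iso e'.symm hrel₁) hrel₂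
    have := finite_of_mem_addOf hZ₁
    have := finite_of_mem_bracket hZ₂
    refine ⟨ModuleCat.of A (X' × (M' × Y')), Z, iso ?_ hrel,
      bracket_of_ses hZs hZs.finite_mid hZ₁ hZ₂⟩
    exact (LinearEquiv.prodCongr e.symm (LinearEquiv.refl A (M' × Y'))).trans
      (LinearEquiv.prodAssoc A X X' (M' × Y'))

theorem extDim_le_of {C : Type u} [Ring C] {n : ℕ}
    (h : ∀ (m : ℕ) (M : ModuleCat.{u} A), Module.Finite A M →
      (∀ X : ModuleCat.{u} A, Module.Finite A X → X ∈ bracket A M (m + 1)) →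
      ∃ N : ModuleCat.{u} C, Module.Finite C N ∧
        ∀ Y : ModuleCat.{u} C, Module.Finite C Y → Y ∈ bracket C N (m + n + 1)) :
    extDim C ≤ extDim A + n := by
  rcases Set.eq_empty_or_nonempty {d : ℕ∞ | ∃ n : ℕ, d = n ∧ ∃ T : ModuleCat.{u} A,
    Module.Finite A T ∧ ∀ X : ModuleCat.{u} A, Module.Finite A X → X ∈ bracket A T (n + 1)}
    with h0 | h0
  · rw [show extDim A = ⊤ by rw [extDim, h0, sInf_empty]]
    simp
  · obtain ⟨m, hm, M, hM, hX⟩ := csInf_mem h0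
    obtain ⟨N, hN, hY⟩ := h m M hM hX
    rw [show extDim A = m from hm]
    exact sInf_le ⟨m + n, by push_cast; rfl, N, hN, hY⟩

end Bracket

section ExtVanishing

variable {A : Type u} [Ring A] {X Y Z : ModuleCat.{u} A} {f : X →ₗ[A] Y} {g : Y →ₗ[A] Z}

theorem IsSES.shortExact (h : IsSES A f g) :
    (ShortComplex.mk (ModuleCat.ofHom f) (ModuleCat.ofHom g)
      (by ext x; exact h.comp_apply x)).ShortExact where
  exact := (ShortComplex.ShortExact.moduleCat_exact_iff_function_exact _).2 fun y ↦
    ⟨h.exists_preimage, by rintro ⟨x, rfl⟩; exact h.comp_apply x⟩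
  mono_f := (ModuleCat.mono_iff_injective _).2 h.1
  epi_g := (ModuleCat.epi_iff_surjective _).2 h.2.1

variable [HasExt.{u} (ModuleCat.{u} A)]

/-- `Ext^i(V, L) = 0`. -/
abbrev ExtZero (V L : ModuleCat.{u} A) (i : ℕ) : Prop := Subsingleton (Abelian.Ext V L i)

open Abelian

theorem ExtZero.retract_left {V V' L : ModuleCat.{u} A} {i : ℕ} (hV : ExtZero V' L i)
    (h : IsRetract V V') : ExtZero V L i := by
  obtain ⟨s, r, hrs⟩ := h
  refine subsingleton_of_forall_eq 0 fun e ↦ ?_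
  have h1 : ModuleCat.ofHom s ≫ ModuleCat.ofHom r = 𝟙 V := by
    ext x; exact congr($hrs x)
  rw [← Ext.mk₀_id_comp e, ← h1, ← Ext.mk₀_comp_mk₀_assoc,
    Subsingleton.elim ((Ext.mk₀ (ModuleCat.ofHom r)).comp e _) 0, Ext.comp_zero]

theorem ExtZero.retract_right {V L L' : ModuleCat.{u} A} {i : ℕ} (hL : ExtZero V L' i)
    (h : IsRetract L L') : ExtZero V L i := by
  obtain ⟨s, r, hrs⟩ := h
  refine subsingleton_of_forall_eq 0 fun e ↦ ?_
  have h1 : ModuleCat.ofHom s ≫ ModuleCat.ofHom r = 𝟙 L := by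
    ext x; exact congr($hrs x)
  rw [← Ext.comp_mk₀_id e, ← h1, ← Ext.mk₀_comp_mk₀, ← Ext.comp_assoc_of_third_deg_zero,
    Subsingleton.elim (e.comp (Ext.mk₀ (ModuleCat.ofHom s)) _) 0, Ext.zero_comp]

theorem ExtZero.of_projective {V L : ModuleCat.{u} A} [Module.Projective A V] {i : ℕ}
    (hi : 0 < i) : ExtZero V L i := by
  obtain ⟨i, rfl⟩ := Nat.exists_eq_succ_of_ne_zero hi.ne'
  have : Projective V := (IsProjective.iff_projective V).1 inferInstance
  exact Ext.subsingleton_of_projective V L i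

theorem ExtZero.of_injective {V L : ModuleCat.{u} A} (hL : Module.Injective A L) {i : ℕ}
    (hi : 0 < i) : ExtZero V L i := by
  obtain ⟨i, rfl⟩ := Nat.exists_eq_succ_of_ne_zero hi.ne'
  have : Injective L := (Module.injective_iff_injective_object A L).1 hL
  exact Ext.subsingleton_of_injective V L i

theorem ExtZero.of_subsingleton_left {V L : ModuleCat.{u} A} [Subsingleton V] {i : ℕ} :
    ExtZero V L i := by
  refine subsingleton_of_forall_eq 0 fun e ↦ ?_
  rw [← Ext.mk₀_id_comp e, show 𝟙 V = 0 by ext x; exact Subsingleton.elim _ _, Ext.mk₀_zero,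
    Ext.zero_comp]

theorem ExtZero.of_subsingleton_right {V L : ModuleCat.{u} A} [Subsingleton L] {i : ℕ} :
    ExtZero V L i := by
  refine subsingleton_of_forall_eq 0 fun e ↦ ?_
  rw [← Ext.comp_mk₀_id e, show 𝟙 L = 0 by ext x; exact Subsingleton.elim _ _, Ext.mk₀_zero,
    Ext.comp_zero]

theorem IsSES.extZero_right_mid (h : IsSES A f g) {V : ModuleCat.{u} A} {i : ℕ}
    (hX : ExtZero V X i) (hZ : ExtZero V Z i) : ExtZero V Y i := by
  refine subsingleton_of_forall_eq 0 fun e ↦ ?_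
  obtain ⟨e', rfl⟩ := Ext.covariant_sequence_exact₂ V h.shortExact e (Subsingleton.elim (α := Ext V Z i) _ _)
  rw [Subsingleton.elim (α := Ext V X i) e' 0, Ext.zero_comp]

theorem IsSES.extZero_right_right (h : IsSES A f g) {V : ModuleCat.{u} A} {i : ℕ}
    (hY : ExtZero V Y i) (hX : ExtZero V X (i + 1)) : ExtZero V Z i := by
  refine subsingleton_of_forall_eq 0 fun e ↦ ?_
  obtain ⟨e', rfl⟩ := Ext.covariant_sequence_exact₃ V h.shortExact e rfl
    (Subsingleton.elim (α := Ext V X (i + 1)) _ _)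
  rw [Subsingleton.elim (α := Ext V Y i) e' 0, Ext.zero_comp]

theorem IsSES.extZero_right_left (h : IsSES A f g) {V : ModuleCat.{u} A} {i : ℕ}
    (hZ : ExtZero V Z i) (hY : ExtZero V Y (i + 1)) : ExtZero V X (i + 1) := by
  refine subsingleton_of_forall_eq 0 fun e ↦ ?_
  obtain ⟨e', rfl⟩ := Ext.covariant_sequence_exact₁ V h.shortExact e
    (Subsingleton.elim (α := Ext V Y (i + 1)) _ _) rfl
  rw [Subsingleton.elim (α := Ext V Z i) e' 0, Ext.zero_comp]

theorem IsSES.extZero_left_mid (h : IsSES A f g) {L : ModuleCat.{u} A} {i : ℕ}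
    (hX : ExtZero X L i) (hZ : ExtZero Z L i) : ExtZero Y L i := by
  refine subsingleton_of_forall_eq 0 fun e ↦ ?_
  obtain ⟨e', rfl⟩ := Ext.contravariant_sequence_exact₂ h.shortExact L e
    (Subsingleton.elim (α := Ext X L i) _ _)
  rw [Subsingleton.elim (α := Ext Z L i) e' 0, Ext.comp_zero]

theorem IsSES.extZero_left_right (h : IsSES A f g) {L : ModuleCat.{u} A} {i : ℕ}
    (hX : ExtZero X L i) (hY : ExtZero Y L (i + 1)) : ExtZero Z L (i + 1) := by
  refine subsingleton_of_forall_eq 0 fun e ↦ ?_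
  obtain ⟨e', rfl⟩ := Ext.contravariant_sequence_exact₃ h.shortExact L e
    (Subsingleton.elim (α := Ext Y L (i + 1)) _ _) (add_comm 1 i)
  rw [Subsingleton.elim (α := Ext X L i) e' 0, Ext.comp_zero]

theorem IsSES.extZero_left_left (h : IsSES A f g) {L : ModuleCat.{u} A} {i : ℕ}
    (hY : ExtZero Y L i) (hZ : ExtZero Z L (i + 1)) : ExtZero X L i := by
  refine subsingleton_of_forall_eq 0 fun e ↦ ?_
  obtain ⟨e', rfl⟩ := Ext.contravariant_sequence_exact₁ h.shortExact L e (add_comm 1 i)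
    (Subsingleton.elim (α := Ext Z L (i + 1)) _ _)
  rw [Subsingleton.elim (α := Ext Y L i) e' 0, Ext.comp_zero]

theorem IsSES.lift_of_extZero (h : IsSES A f g) {V : ModuleCat.{u} A} (hX : ExtZero V X 1)
    (p : V →ₗ[A] Z) : ∃ q : V →ₗ[A] Y, ∀ v, g (q v) = p v := by
  obtain ⟨e, he⟩ := Ext.covariant_sequence_exact₃ V h.shortExact (Ext.mk₀ (ModuleCat.ofHom p))
    rfl (Subsingleton.elim (α := Ext V X 1) _ _)
  obtain ⟨q, rfl⟩ := (Ext.mk₀_bijective _ _).2 e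
  rw [Ext.mk₀_comp_mk₀] at he
  have := (Ext.mk₀_bijective _ _).1 he
  exact ⟨q.hom, fun v ↦ congr(($this).hom v)⟩

theorem IsSES.extend_of_extZero (h : IsSES A f g) {L : ModuleCat.{u} A} (hZ : ExtZero Z L 1)
    (p : X →ₗ[A] L) : ∃ q : Y →ₗ[A] L, ∀ x, q (f x) = p x := by
  obtain ⟨e, he⟩ := Ext.contravariant_sequence_exact₁ h.shortExact L
    (Ext.mk₀ (ModuleCat.ofHom p)) rfl (Subsingleton.elim (α := Ext Z L 1) _ _)
  obtain ⟨q, rfl⟩ := (Ext.mk₀_bijective _ _).2 e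
  rw [Ext.mk₀_comp_mk₀] at he
  have := (Ext.mk₀_bijective _ _).1 he
  exact ⟨q.hom, fun v ↦ congr(($this).hom v)⟩

theorem IsSES.extZero_one_of_lift (h : IsSES A f g) {V : ModuleCat.{u} A} (hY : ExtZero V Y 1)
    (hl : ∀ p : V →ₗ[A] Z, ∃ q : V →ₗ[A] Y, ∀ v, g (q v) = p v) : ExtZero V X 1 := by
  refine subsingleton_of_forall_eq 0 fun e ↦ ?_
  obtain ⟨e', rfl⟩ := Ext.covariant_sequence_exact₁ V h.shortExact e
    (Subsingleton.elim (α := Ext V Y 1) _ _) rfl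
  obtain ⟨p, rfl⟩ := (Ext.mk₀_bijective _ _).2 e'
  obtain ⟨q, hq⟩ := hl p.hom
  have : p = ModuleCat.ofHom q ≫ ModuleCat.ofHom g := by ext v; exact (hq v).symm
  rw [this, ← Ext.mk₀_comp_mk₀, Ext.comp_assoc_of_second_deg_zero]
  have h0 := h.shortExact.comp_extClass
  dsimp only at h0 ⊢
  rw [h0, Ext.comp_zero]

theorem IsSES.extZero_one_of_extend (h : IsSES A f g) {L : ModuleCat.{u} A}
    (hY : ExtZero Y L 1)
    (hl : ∀ p : X →ₗ[A] L, ∃ q : Y →ₗ[A] L, ∀ x, q (f x) = p x) : ExtZero Z L 1 := by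
  refine subsingleton_of_forall_eq 0 fun e ↦ ?_
  obtain ⟨e', rfl⟩ := Ext.contravariant_sequence_exact₃ h.shortExact L e
    (Subsingleton.elim (α := Ext Y L 1) _ _) (add_zero 1)
  obtain ⟨p, rfl⟩ := (Ext.mk₀_bijective _ _).2 e'
  obtain ⟨q, hq⟩ := hl p.hom
  have : p = ModuleCat.ofHom f ≫ ModuleCat.ofHom q := by ext v; exact (hq v).symm
  rw [this, ← Ext.mk₀_comp_mk₀]
  exact h.shortExact.extClass_comp_assoc _

theorem ExtZero.prod_left {V V' L : ModuleCat.{u} A} {i : ℕ} (h : ExtZero V L i)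
    (h' : ExtZero V' L i) : ExtZero (ModuleCat.of A (V × V')) L i :=
  (isSES_split V V').extZero_left_mid h h'

theorem ExtZero.prod_right {V L L' : ModuleCat.{u} A} {i : ℕ} (h : ExtZero V L i)
    (h' : ExtZero V L' i) : ExtZero V (ModuleCat.of A (L × L')) i :=
  (isSES_split L L').extZero_right_mid h h'

theorem ExtZero.addOf_left {T V L : ModuleCat.{u} A} {i : ℕ} (h : ExtZero T L i)
    (hV : V ∈ addOf A T) : ExtZero V L i :=
  memAdd.induction (Q := {V | ExtZero V L i}) (by rintro _ rfl; exact h)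
    (fun hr h ↦ h.retract_left hr) (fun _ _ ↦ .of_subsingleton_left)
    (fun _ _ h h' ↦ h.prod_left h') hV

theorem ExtZero.addOf_right {T V L : ModuleCat.{u} A} {i : ℕ} (h : ExtZero V T i)
    (hL : L ∈ addOf A T) : ExtZero V L i :=
  memAdd.induction (Q := {L | ExtZero V L i}) (by rintro _ rfl; exact h)
    (fun hr h ↦ h.retract_right hr) (fun _ _ ↦ .of_subsingleton_right)
    (fun _ _ h h' ↦ h.prod_right h') hL

theorem ProjRes.extZero : ∀ {j : ℕ} {V : ModuleCat.{u} A}, ProjRes A V j →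
    ∀ {L : ModuleCat.{u} A} {i : ℕ}, j < i → ExtZero V L i
  | 0, V, hV, L, i, hi => by
    have : Module.Projective A V := hV
    exact .of_projective hi
  | j + 1, V, ⟨P, g, hP, _, hg, hker⟩, L, i, hi => by
    obtain ⟨i, rfl⟩ := Nat.exists_eq_succ_of_ne_zero (Nat.ne_zero_of_lt hi)
    exact (isSES_of_surjective hg).extZero_left_right
      (ProjRes.extZero hker (Nat.lt_of_succ_lt_succ hi)) (.of_projective i.succ_pos)

end ExtVanishing

section Diagrams

variable {A : Type u} [Ring A]

theorem exists_pullback {X Y Z : ModuleCat.{u} A} (f : X →ₗ[A] Z) (g : Y →ₗ[A] Z) :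
    ∃ (P : ModuleCat.{u} A) (a : P →ₗ[A] X) (b : P →ₗ[A] Y), (∀ p, f (a p) = g (b p)) ∧
      (∀ p, a p = 0 → b p = 0 → p = 0) ∧
      (∀ {L : ModuleCat.{u} A} (v : L →ₗ[A] X) (w : L →ₗ[A] Y), (∀ l, f (v l) = g (w l)) →
        ∃ q : L →ₗ[A] P, (∀ l, a (q l) = v l) ∧ ∀ l, b (q l) = w l) ∧
      (∀ x y, f x = g y → ∃ p, a p = x ∧ b p = y) ∧
      (IsNoetherianRing A → Module.Finite A X → Module.Finite A Y → Module.Finite A P) := by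
  let K := LinearMap.ker (f ∘ₗ LinearMap.fst A X Y - g ∘ₗ LinearMap.snd A X Y)
  refine ⟨ModuleCat.of A K, LinearMap.fst A X Y ∘ₗ K.subtype, LinearMap.snd A X Y ∘ₗ K.subtype,
    fun p ↦ ?_, fun p h1 h2 ↦ Subtype.ext (Prod.ext h1 h2), fun v w h ↦ ?_, fun x y h ↦ ?_,
    fun _ _ _ ↦ inferInstanceAs (Module.Finite A K)⟩
  · exact sub_eq_zero.1 p.2
  · exact ⟨(v.prod w).codRestrict K fun l ↦ sub_eq_zero.2 (h l), fun _ ↦ rfl, fun _ ↦ rfl⟩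
  · exact ⟨⟨(x, y), sub_eq_zero.2 h⟩, rfl, rfl⟩

theorem exists_pushout {X Y Z : ModuleCat.{u} A} (f : X →ₗ[A] Y) (g : X →ₗ[A] Z) :
    ∃ (Q : ModuleCat.{u} A) (a : Y →ₗ[A] Q) (b : Z →ₗ[A] Q), (∀ x, a (f x) = b (g x)) ∧
      (∀ q, ∃ y z, q = a y + b z) ∧
      (∀ y z, a y + b z = 0 → ∃ x, y = f x ∧ z = - g x) ∧
      (∀ {L : ModuleCat.{u} A} (v : Y →ₗ[A] L) (w : Z →ₗ[A] L), (∀ x, v (f x) = w (g x)) →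
        ∃ q : Q →ₗ[A] L, (∀ y, q (a y) = v y) ∧ ∀ z, q (b z) = w z) := by
  let R := LinearMap.range (f.prod (-g))
  refine ⟨ModuleCat.of A ((Y × Z) ⧸ R), R.mkQ ∘ₗ LinearMap.inl A Y Z,
    R.mkQ ∘ₗ LinearMap.inr A Y Z, fun x ↦ ?_, fun q ↦ ?_, fun y z h ↦ ?_, fun v w h ↦ ?_⟩
  · exact (Submodule.Quotient.eq R).2 ⟨x, by simp⟩
  · obtain ⟨⟨y, z⟩, rfl⟩ := R.mkQ_surjective q
    exact ⟨y, z, by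
      simp only [LinearMap.comp_apply]
      rw [← map_add]; simp⟩
  · simp only [LinearMap.comp_apply] at h
    rw [← map_add] at h
    obtain ⟨x, hx⟩ := (Submodule.Quotient.mk_eq_zero R).1 h
    exact ⟨x, by simpa using congr(($hx).1).symm, by simpa using congr(($hx).2).symm⟩
  · refine ⟨R.liftQ (v.coprod w) ?_, fun y ↦ ?_, fun z ↦ ?_⟩
    · rintro _ ⟨x, rfl⟩
      simp [h]
    · simp
    · simp

theorem IsSES.pushout {X Y Z J W : ModuleCat.{u} A} {f : X →ₗ[A] Y} {g : Y →ₗ[A] Z}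
    (h : IsSES A f g) {j : X →ₗ[A] J} {p : J →ₗ[A] W} (hj : IsSES A j p) :
    ∃ (E : ModuleCat.{u} A) (c : Y →ₗ[A] E) (t : E →ₗ[A] W) (d : J →ₗ[A] E) (s : E →ₗ[A] Z),
      IsSES A c t ∧ IsSES A d s := by
  obtain ⟨E, c, d, hcd, hE, hE0, hEl⟩ := exists_pushout f j
  obtain ⟨t, ht, ht'⟩ := hEl (L := W) 0 p fun x ↦ by simp [hj.comp_apply]
  obtain ⟨s, hs, hs'⟩ := hEl (L := Z) g 0 fun x ↦ by simp [h.comp_apply]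
  refine ⟨E, c, t, d, s, .mk' ?_ ?_ ht ?_, .mk' ?_ ?_ hs' ?_⟩
  · rw [injective_iff_map_eq_zero]
    intro y hy
    obtain ⟨x, rfl, hx⟩ := hE0 y 0 (by simpa using hy)
    rw [show x = 0 from hj.1 (by rw [map_zero]; simpa using hx.symm), map_zero]
  · intro w
    obtain ⟨w, rfl⟩ := hj.2.1 w
    exact ⟨d w, ht' w⟩
  · intro e he
    obtain ⟨y, z, rfl⟩ := hE e
    rw [map_add, ht, ht', LinearMap.zero_apply, zero_add] at he
    obtain ⟨x, rfl⟩ := hj.exists_preimage he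
    exact ⟨y + f x, by rw [map_add, hcd]⟩
  · rw [injective_iff_map_eq_zero]
    intro y hy
    obtain ⟨x, hx, rfl⟩ := hE0 0 y (by simpa using hy)
    rw [show x = 0 from h.1 (by rw [map_zero, ← hx]), map_zero, neg_zero]
  · intro w
    obtain ⟨w, rfl⟩ := h.2.1 w
    exact ⟨c w, hs w⟩
  · intro e he
    obtain ⟨y, z, rfl⟩ := hE e
    rw [map_add, hs, hs', LinearMap.zero_apply, add_zero] at he
    obtain ⟨x, rfl⟩ := h.exists_preimage he
    exact ⟨j x + z, by rw [map_add, hcd]⟩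

/-- The cokernels of a monomorphism of short exact sequences form a short exact sequence. -/
theorem IsSES.nine {X₁ X X₂ U₁ U U₂ V₁ V₂ : ModuleCat.{u} A} {f : X₁ →ₗ[A] X} {g : X →ₗ[A] X₂}
    {f' : U₁ →ₗ[A] U} {g' : U →ₗ[A] U₂} (h : IsSES A f g) (h' : IsSES A f' g')
    {a₁ : X₁ →ₗ[A] U₁} {b₁ : U₁ →ₗ[A] V₁} (h₁ : IsSES A a₁ b₁)
    {a₂ : X₂ →ₗ[A] U₂} {b₂ : U₂ →ₗ[A] V₂} (h₂ : IsSES A a₂ b₂)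
    {a : X →ₗ[A] U} (hf : ∀ x, a (f x) = f' (a₁ x)) (hg : ∀ x, g' (a x) = a₂ (g x)) :
    ∃ (V : ModuleCat.{u} A) (b : U →ₗ[A] V) (v : V₁ →ₗ[A] V) (w : V →ₗ[A] V₂),
      IsSES A a b ∧ IsSES A v w := by
  have ha : Function.Injective a := by
    rw [injective_iff_map_eq_zero]
    intro x hx
    obtain ⟨y, rfl⟩ := h.exists_preimage (y := x)
      (h₂.1 (by rw [← hg, hx, map_zero, map_zero]))
    rw [hf] at hx
    rw [h₁.1 ((h'.1 (hx.trans (map_zero f').symm)).trans (map_zero a₁).symm), map_zero]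
  have hs := isSES_of_injective ha
  obtain ⟨v, hv⟩ := h₁.exists_desc ((LinearMap.range a).mkQ ∘ₗ f')
    (L := ModuleCat.of A (U ⧸ LinearMap.range a)) fun x ↦ by
      rw [LinearMap.comp_apply, ← hf]; exact hs.comp_apply _
  obtain ⟨w, hw⟩ := hs.exists_desc (b₂ ∘ₗ g') fun x ↦ by
    rw [LinearMap.comp_apply, hg]; exact h₂.comp_apply _
  refine ⟨_, _, v, w, hs, .mk' ?_ ?_ ?_ ?_⟩
  · rw [injective_iff_map_eq_zero]
    intro y hy
    obtain ⟨y, rfl⟩ := h₁.2.1 y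
    rw [hv] at hy
    obtain ⟨x, hx⟩ := hs.exists_preimage hy
    obtain ⟨m, rfl⟩ := h.exists_preimage (y := x)
      (h₂.1 (by rw [← hg, hx, h'.comp_apply, map_zero]))
    rw [hf] at hx
    rw [← h'.1 hx, h₁.comp_apply]
  · intro y
    obtain ⟨y, rfl⟩ := h₂.2.1 y
    obtain ⟨y, rfl⟩ := h'.2.1 y
    exact ⟨_, hw y⟩
  · intro y
    obtain ⟨y, rfl⟩ := h₁.2.1 y
    rw [hv, LinearMap.comp_apply, hw, LinearMap.comp_apply, h'.comp_apply, map_zero]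
  · intro p hp
    obtain ⟨p, rfl⟩ := hs.2.1 p
    rw [hw] at hp
    obtain ⟨m, hm⟩ := h₂.exists_preimage hp
    obtain ⟨x, rfl⟩ := h.2.1 m
    obtain ⟨y, hy⟩ := h'.exists_preimage (y := p - a x) (by rw [map_sub, hg, hm, sub_self])
    refine ⟨b₁ y, ?_⟩
    rw [hv, LinearMap.comp_apply, hy, map_sub, hs.comp_apply, sub_zero]

theorem extend_of_injective {X Y J : ModuleCat.{u} A} (hJ : Module.Injective A J)
    {f : X →ₗ[A] Y} (hf : Function.Injective f) (p : X →ₗ[A] J) :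
    ∃ q : Y →ₗ[A] J, ∀ x, q (f x) = p x :=
  hJ.out f hf p

theorem injective_prod {J J' : ModuleCat.{u} A} (hJ : Module.Injective A J)
    (hJ' : Module.Injective A J') : Module.Injective A (ModuleCat.of A (J × J')) where
  out _ _ _ _ _ _ f hf p := by
    obtain ⟨q, hq⟩ := hJ.out f hf (LinearMap.fst A J J' ∘ₗ p)
    obtain ⟨q', hq'⟩ := hJ'.out f hf (LinearMap.snd A J J' ∘ₗ p)
    exact ⟨q.prod q', fun x ↦ Prod.ext (hq x) (hq' x)⟩

theorem IsSES.isRetract_of_injective {X Y Z : ModuleCat.{u} A} {f : X →ₗ[A] Y} {g : Y →ₗ[A] Z}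
    (h : IsSES A f g) (hX : Module.Injective A X) : IsRetract Z Y := by
  obtain ⟨r, hr⟩ := extend_of_injective hX h.1 LinearMap.id
  obtain ⟨s, hs⟩ := h.exists_desc (LinearMap.id - f ∘ₗ r) fun x ↦ by simp [hr]
  refine ⟨s, g, LinearMap.ext fun z ↦ ?_⟩
  obtain ⟨y, rfl⟩ := h.2.1 z
  simp [hs, h.comp_apply]

/-- The finitely generated modules embed in powers of one finitely generated injective. -/
def HasInjCogen (A : Type u) [Ring A] : Prop :=
  ∃ G : ModuleCat.{u} A, Module.Finite A G ∧ Module.Injective A G ∧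
    ∀ X : ModuleCat.{u} A, Module.Finite A X → ∃ (r : ℕ) (f : X →ₗ[A] (Fin r → G)),
      Function.Injective f

theorem HasInjCogen.exists_embedding (hA : HasInjCogen A) (X : ModuleCat.{u} A)
    (hX : Module.Finite A X) : ∃ (J Z : ModuleCat.{u} A) (f : X →ₗ[A] J) (g : J →ₗ[A] Z),
      Module.Finite A J ∧ Module.Injective A J ∧ IsSES A f g := by
  obtain ⟨G, _, hG, h⟩ := hA
  obtain ⟨r, f, hf⟩ := h X hX
  exact ⟨ModuleCat.of A (Fin r → G), _, f, _, inferInstanceAs (Module.Finite A (Fin r → G)),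
    inferInstanceAs (Module.Injective A (Fin r → G)), isSES_of_injective hf⟩

end Diagrams

section Cosyzygy

variable {A : Type u} [Ring A]

/-- `Z` is a cosyzygy of `X`. -/
def IsCosyzygy (X Z : ModuleCat.{u} A) : Prop :=
  ∃ (J : ModuleCat.{u} A) (f : X →ₗ[A] J) (g : J →ₗ[A] Z),
    Module.Finite A J ∧ Module.Injective A J ∧ IsSES A f g

theorem IsCosyzygy.prod {X Z X' Z' : ModuleCat.{u} A} (h : IsCosyzygy X Z)
    (h' : IsCosyzygy X' Z') :
    IsCosyzygy (ModuleCat.of A (X × X')) (ModuleCat.of A (Z × Z')) := by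
  obtain ⟨J, f, g, _, hJ, h⟩ := h
  obtain ⟨J', f', g', _, hJ', h'⟩ := h'
  exact ⟨_, _, _, inferInstanceAs (Module.Finite A (J × J')), injective_prod hJ hJ', h.prod h'⟩

theorem IsCosyzygy.equiv {X Y Z : ModuleCat.{u} A} (e : X ≃ₗ[A] Y) (h : IsCosyzygy X Z) :
    IsCosyzygy Y Z := by
  obtain ⟨J, f, g, hJ, hJ', h⟩ := h
  exact ⟨J, _, g, hJ, hJ', h.equiv_left e.symm⟩

theorem IsCosyzygy.horseshoe {X W Y : ModuleCat.{u} A} {f : X →ₗ[A] W} {g : W →ₗ[A] Y}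
    {Z₁ Z₂ : ModuleCat.{u} A} (h : IsSES A f g) (h₁ : IsCosyzygy X Z₁) (h₂ : IsCosyzygy Y Z₂) :
    ∃ (Z : ModuleCat.{u} A) (f' : Z₁ →ₗ[A] Z) (g' : Z →ₗ[A] Z₂),
      IsCosyzygy W Z ∧ IsSES A f' g' := by
  obtain ⟨J₁, a₁, b₁, _, hJ₁, h₁⟩ := h₁
  obtain ⟨J₂, a₂, b₂, _, hJ₂, h₂⟩ := h₂
  obtain ⟨p, hp⟩ := extend_of_injective hJ₁ h.1 a₁
  obtain ⟨Z, b, v, w, hb, hvw⟩ := h.nine (isSES_split J₁ J₂) h₁ h₂ (a := p.prod (a₂ ∘ₗ g))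
    (fun x ↦ Prod.ext (hp x) (by simp [h.comp_apply])) fun _ ↦ rfl
  exact ⟨Z, v, w, ⟨_, _, b, inferInstanceAs (Module.Finite A (J₁ × J₂)),
    injective_prod hJ₁ hJ₂, hb⟩, hvw⟩

theorem exists_bracket_cosyzygy [IsNoetherianRing A] (hA : HasInjCogen A)
    (N : ModuleCat.{u} A) (hN : Module.Finite A N) :
    ∃ N' : ModuleCat.{u} A, Module.Finite A N' ∧
      ∀ (q : ℕ) (Y' P Y : ModuleCat.{u} A) (f : Y' →ₗ[A] P) (g : P →ₗ[A] Y), IsSES A f g →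
        P ∈ addOf A (ModuleCat.of A A) → Y' ∈ bracket A N (q + 1) →
          Y ∈ bracket A N' (q + 2) := by
  have hA' := hA
  obtain ⟨G, hG, hGi, hemb⟩ := hA
  obtain ⟨J₀, SN, f₀, g₀, hJ₀, hJ₀i, h₀⟩ := hA'.exists_embedding N hN
  have hS : Module.Finite A SN := h₀.finite_right
  let N' := ModuleCat.of A ((A × G) × SN)
  have hN' : Module.Finite A N' := inferInstanceAs (Module.Finite A ((A × G) × SN))
  have hAG : IsRetract (ModuleCat.of A (A × G)) N' := IsRetract.fst (ModuleCat.of A (A × G)) SN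
  have hAN : IsRetract (ModuleCat.of A A) N' := (IsRetract.fst (ModuleCat.of A A) G).trans hAG
  have hGN : IsRetract G N' := (IsRetract.snd (ModuleCat.of A A) G).trans hAG
  have hSN : IsRetract SN N' := IsRetract.snd (ModuleCat.of A (A × G)) SN
  refine ⟨N', hN', fun q Y' P Y f g h hP hY' ↦ ?_⟩
  obtain ⟨Y'', Z, ⟨J, j, b, hJ, hJi, hj⟩, hZ⟩ := bracket_transfer (M := N) (N := SN) IsCosyzygy
    IsCosyzygy.equiv (fun r ↦ pi_mem (M := fun _ ↦ N)
      (Q := {X | ∃ Z ∈ addOf A SN, IsCosyzygy X Z})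
      (fun e ⟨Z, hZ, h⟩ ↦ ⟨Z, hZ, h.equiv e⟩)
      (fun X _ ↦ ⟨X, memAdd.of_subsingleton, X, LinearMap.id, LinearMap.id, inferInstance,
        ⟨fun _ _ _ _ _ _ _ _ _ ↦ ⟨0, fun _ ↦ Subsingleton.elim _ _⟩⟩,
        .mk' Function.injective_id Function.surjective_id (fun _ ↦ Subsingleton.elim _ _)
        fun y _ ↦ ⟨y, rfl⟩⟩)
      (fun X Y ⟨Z, hZ, h⟩ ⟨Z', hZ', h'⟩ ↦ ⟨_, hZ.prod hZ', h.prod h'⟩)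
      fun _ ↦ ⟨SN, addOf_self _, J₀, f₀, g₀, hJ₀, hJ₀i, h₀⟩)
    IsCosyzygy.horseshoe hY'
  have hYY : Module.Finite A (ModuleCat.of A (Y' × Y'')) := hj.finite_left
  obtain ⟨r, j', hj'⟩ := hemb Y'' (IsRetract.snd Y' Y'').finite
  have hs := h.prod (isSES_of_injective (Y := ModuleCat.of A (Fin r → G)) hj')
  obtain ⟨E, c, t, d, s, hct, hds⟩ := hs.pushout hj
  have hPG : ModuleCat.of A (P × (Fin r → G)) ∈ addOf A N' :=
    memAdd.prod (addOf_mono ((addOf_self N').retract hAN) hP)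
      (addOf_mono ((addOf_self N').retract hGN) (addOf_pi G r))
  have hZ' : Z ∈ bracket A N' (q + 1) := bracket_mono ((addOf_self N').retract hSN) hZ
  have := finite_of_mem_addOf hPG
  have := finite_of_mem_bracket hZ'
  exact bracket_retract (bracket_of_ses hct hct.finite_mid hPG hZ')
    ((IsRetract.fst _ _).trans (hds.isRetract_of_injective hJi))

end Cosyzygy

section HomFunctor

variable {A : Type u} [Ring A]

/-- The opposite of `End_A(T)` acts on `Hom_A(T, X)` by precomposition. -/
instance homModule (T X : Type u) [AddCommGroup T] [Module A T] [AddCommGroup X] [Module A X] :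
    Module (Module.End A T)ᵐᵒᵖ (T →ₗ[A] X) where
  smul c h := h ∘ₗ c.unop
  one_smul _ := rfl
  mul_smul _ _ _ := rfl
  smul_zero _ := rfl
  smul_add _ _ _ := rfl
  add_smul _ _ _ := LinearMap.comp_add _ _ _
  zero_smul _ := LinearMap.comp_zero _

/-- `Hom_A(T, X)` as a module over the opposite of `End_A(T)`. -/
abbrev homT (T X : ModuleCat.{u} A) : ModuleCat.{u} (Module.End A T)ᵐᵒᵖ :=
  ModuleCat.of (Module.End A T)ᵐᵒᵖ (T →ₗ[A] X)

/-- Postcomposition with `f`. -/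
def homMap (T : ModuleCat.{u} A) {X Y : ModuleCat.{u} A} (f : X →ₗ[A] Y) :
    homT T X →ₗ[(Module.End A T)ᵐᵒᵖ] homT T Y where
  toFun h := f ∘ₗ (h : T →ₗ[A] X)
  map_add' _ _ := LinearMap.comp_add _ _ _
  map_smul' _ _ := rfl

variable {T : ModuleCat.{u} A}

theorem homT_retract {X Y : ModuleCat.{u} A} (h : IsRetract X Y) :
    IsRetract (homT T X) (homT T Y) := by
  obtain ⟨s, r, hrs⟩ := h
  refine ⟨homMap T s, homMap T r, LinearMap.ext fun h ↦ ?_⟩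
  change r ∘ₗ (s ∘ₗ h) = h
  rw [← LinearMap.comp_assoc, hrs, LinearMap.id_comp]

/-- `Hom_A(T, X)` commutes with products in the second variable. -/
def homTProd (T X Y : ModuleCat.{u} A) :
    homT T (ModuleCat.of A (X × Y)) ≃ₗ[(Module.End A T)ᵐᵒᵖ] (homT T X × homT T Y) where
  toFun h := (LinearMap.fst A X Y ∘ₗ h, LinearMap.snd A X Y ∘ₗ h)
  map_add' _ _ := rfl
  map_smul' _ _ := rfl
  invFun h := LinearMap.prod h.1 h.2
  left_inv _ := rfl
  right_inv _ := rfl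

/-- `Hom_A(T, T^r)` is free of rank `r`. -/
def homTPow (T : ModuleCat.{u} A) (r : ℕ) :
    homT T (ModuleCat.of A (Fin r → T)) ≃ₗ[(Module.End A T)ᵐᵒᵖ]
      (Fin r → (Module.End A T)ᵐᵒᵖ) where
  toFun h i := MulOpposite.op (LinearMap.proj i ∘ₗ (h : T →ₗ[A] (Fin r → T)) : Module.End A T)
  map_add' _ _ := rfl
  map_smul' _ _ := rfl
  invFun c := LinearMap.pi fun i ↦ (MulOpposite.unop (c i) : T →ₗ[A] T)
  left_inv _ := rfl
  right_inv _ := rfl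

theorem homT_addOf {X : ModuleCat.{u} A} (hX : X ∈ addOf A T) :
    homT T X ∈ addOf _ (ModuleCat.of _ (Module.End A T)ᵐᵒᵖ) := by
  obtain ⟨r, h⟩ := mem_addOf_iff.1 hX
  exact mem_addOf_iff.2 ⟨r, (homT_retract h).trans (.of_equiv (homTPow T r))⟩

/-- A finitely generated submodule of `Hom_A(T, X)` is the image of `Hom_A(T, p)` for some
`p : T^r → X`. -/
theorem exists_range_homMap {X : ModuleCat.{u} A}
    (K : Submodule (Module.End A T)ᵐᵒᵖ (homT T X)) (hK : K.FG) :
    ∃ (r : ℕ) (p : ModuleCat.of A (Fin r → T) →ₗ[A] X), LinearMap.range (homMap T p) = K := by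
  obtain ⟨r, s, rfl⟩ := Submodule.fg_iff_exists_fin_generating_family.1 hK
  refine ⟨r, ∑ i, (s i : T →ₗ[A] X) ∘ₗ LinearMap.proj i, le_antisymm ?_ ?_⟩
  · rintro _ ⟨h, rfl⟩
    have : homMap T (∑ i, (s i : T →ₗ[A] X) ∘ₗ LinearMap.proj i :
        ModuleCat.of A (Fin r → T) →ₗ[A] X) h = ∑ i, homTPow T r h i • s i := by
      refine LinearMap.ext fun t ↦ ?_
      rw [LinearMap.sum_apply]
      exact LinearMap.sum_apply _ _ _
    rw [this]
    exact Submodule.sum_mem _ fun i _ ↦ Submodule.smul_mem _ _ (Submodule.subset_span ⟨i, rfl⟩)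
  · rw [Submodule.span_le]
    rintro _ ⟨i, rfl⟩
    refine ⟨LinearMap.single A (fun _ ↦ T) i, LinearMap.ext fun t ↦ ?_⟩
    refine (LinearMap.sum_apply _ _ _).trans ?_
    rw [Finset.sum_eq_single i] <;> simp +contextual

end HomFunctor

section Perp

variable {A : Type u} [Ring A] [HasExt.{u} (ModuleCat.{u} A)]

/-- `Ext^i(T, L) = 0` for all `i > 0`. -/
def RightPerp (T L : ModuleCat.{u} A) : Prop := ∀ i : ℕ, 0 < i → ExtZero T L i

/-- `Ext^i(V, L) = 0` for all `i > 0` and all `L` right orthogonal to `T`. -/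
def LeftPerp (T V : ModuleCat.{u} A) : Prop :=
  ∀ L : ModuleCat.{u} A, RightPerp T L → ∀ i : ℕ, 0 < i → ExtZero V L i

variable {T X Y Z : ModuleCat.{u} A} {f : X →ₗ[A] Y} {g : Y →ₗ[A] Z}

theorem RightPerp.of_injective (hX : Module.Injective A X) : RightPerp T X :=
  fun _ hi ↦ .of_injective hX hi

theorem IsSES.rightPerp_mid (h : IsSES A f g) (hX : RightPerp T X) (hZ : RightPerp T Z) :
    RightPerp T Y :=
  fun i hi ↦ h.extZero_right_mid (hX i hi) (hZ i hi)

theorem IsSES.rightPerp_right (h : IsSES A f g) (hX : RightPerp T X) (hY : RightPerp T Y) :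
    RightPerp T Z :=
  fun i hi ↦ h.extZero_right_right (hY i hi) (hX (i + 1) i.succ_pos)

theorem IsSES.rightPerp_left (h : IsSES A f g) (hY : RightPerp T Y) (hZ : RightPerp T Z)
    (hl : ∀ p : T →ₗ[A] Z, ∃ q : T →ₗ[A] Y, ∀ v, g (q v) = p v) : RightPerp T X
  | 1, _ => h.extZero_one_of_lift (hY 1 one_pos) hl
  | i + 2, _ => h.extZero_right_left (hZ (i + 1) i.succ_pos) (hY (i + 2) (i + 1).succ_pos)

theorem IsSES.leftPerp_mid (h : IsSES A f g) (hX : LeftPerp T X) (hZ : LeftPerp T Z) :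
    LeftPerp T Y :=
  fun L hL i hi ↦ h.extZero_left_mid (hX L hL i hi) (hZ L hL i hi)

theorem IsSES.leftPerp_left (h : IsSES A f g) (hY : LeftPerp T Y) (hZ : LeftPerp T Z) :
    LeftPerp T X :=
  fun L hL i hi ↦ h.extZero_left_left (hY L hL i hi) (hZ L hL (i + 1) i.succ_pos)

theorem LeftPerp.of_addOf (hX : X ∈ addOf A T) : LeftPerp T X :=
  fun _ hL i hi ↦ (hL i hi).addOf_left hX

theorem LeftPerp.of_coresBy : ∀ {j : ℕ} {V : ModuleCat.{u} A}, CoresBy A T V j → LeftPerp T V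
  | 0, _, hV => .of_addOf hV
  | _ + 1, _, ⟨_, _, hT₀, hι, hV⟩ =>
    (isSES_of_injective hι).leftPerp_left (.of_addOf hT₀) (.of_coresBy hV)

/-- The homological conditions in the definition of a tilting module. -/
structure IsTilting (T : ModuleCat.{u} A) (n : ℕ) : Prop where
  projRes : ProjRes A T n
  ext : RightPerp T T
  cores : CoresBy A T (ModuleCat.of A A) n

theorem IsTilting.rightPerp_addOf {n : ℕ} (hT : IsTilting T n) (hX : X ∈ addOf A T) :
    RightPerp T X :=
  fun i hi ↦ (hT.ext i hi).addOf_right hX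

theorem exists_factor_of_coresBy {V U : ModuleCat.{u} A} {j : ℕ} (hV : CoresBy A T V j)
    (hU : RightPerp T U) (h : V →ₗ[A] U) :
    ∃ (r : ℕ) (a : V →ₗ[A] (Fin r → T)) (b : (Fin r → T) →ₗ[A] U), ∀ v, b (a v) = h v := by
  cases j with
  | zero =>
    obtain ⟨r, s, p, hsp⟩ := mem_addOf_iff.1 hV
    exact ⟨r, s, h ∘ₗ p, fun v ↦ congr(h ($hsp v))⟩
  | succ j =>
    obtain ⟨T₀, ι, hT₀, hι, hV⟩ := hV
    obtain ⟨q, hq⟩ := (isSES_of_injective hι).extend_of_extZero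
      (LeftPerp.of_coresBy hV U hU 1 one_pos) h
    obtain ⟨r, s, p, hsp⟩ := mem_addOf_iff.1 hT₀
    exact ⟨r, s ∘ₗ ι, q ∘ₗ p, fun v ↦ (congr(q ($hsp (ι v)))).trans (hq v)⟩

/-- Modules right orthogonal to a tilting module `T` are generated by `T`. -/
theorem IsTilting.surjective_of_lift {n : ℕ} (hT : IsTilting T n) {P U : ModuleCat.{u} A}
    (hU : RightPerp T U) (p : P →ₗ[A] U)
    (hp : ∀ h : T →ₗ[A] U, ∃ h' : T →ₗ[A] P, ∀ t, p (h' t) = h t) : Function.Surjective p := by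
  intro x
  obtain ⟨r, a, b, hab⟩ := exists_factor_of_coresBy hT.cores hU (LinearMap.toSpanSingleton A U x)
  choose c hc using fun i ↦ hp (b ∘ₗ LinearMap.single A (fun _ ↦ T) i)
  refine ⟨∑ i, c i (a 1 i), ?_⟩
  have h1 := hab (1 : A)
  rw [LinearMap.toSpanSingleton_apply, one_smul] at h1
  rw [← h1, map_sum]
  simp only [hc, LinearMap.comp_apply]
  rw [← map_sum]
  exact congrArg b (Finset.univ_sum_single (a 1))

theorem IsTilting.exists_approx {n : ℕ} (hT : IsTilting T n) {U : ModuleCat.{u} A}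
    (hU : RightPerp T U) (hfin : Module.Finite (Module.End A T)ᵐᵒᵖ (homT T U)) :
    ∃ (r : ℕ) (K : ModuleCat.{u} A) (k : K →ₗ[A] ModuleCat.of A (Fin r → T))
      (p : ModuleCat.of A (Fin r → T) →ₗ[A] U), IsSES A k p ∧ RightPerp T K := by
  obtain ⟨r, p, hp⟩ := exists_range_homMap (T := T) (X := U) ⊤ hfin.fg_top
  have hl : ∀ h : T →ₗ[A] U, ∃ h' : T →ₗ[A] ModuleCat.of A (Fin r → T),
      ∀ t, p (h' t) = h t := fun h ↦ by
    obtain ⟨h', hh⟩ := LinearMap.range_eq_top.1 hp h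
    exact ⟨h', fun t ↦ congr($hh t)⟩
  have hs := isSES_of_surjective (hT.surjective_of_lift hU p hl)
  exact ⟨r, _, _, p, hs, hs.rightPerp_left (hT.rightPerp_addOf (addOf_pi T r)) hU hl⟩

/-- `U` is a special preenvelope of `X` with respect to the cotorsion pair of `T`. -/
def IsEnvelope (T X U : ModuleCat.{u} A) : Prop :=
  ∃ (V : ModuleCat.{u} A) (f : X →ₗ[A] U) (g : U →ₗ[A] V),
    Module.Finite A U ∧ RightPerp T U ∧ LeftPerp T V ∧ IsSES A f g

theorem IsTilting.exists_envelope [IsNoetherianRing A] (hA : HasInjCogen A) {n : ℕ}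
    (hT : IsTilting T n) [Module.Finite A T]
    (hfin : ∀ X : ModuleCat.{u} A, Module.Finite A X →
      Module.Finite (Module.End A T)ᵐᵒᵖ (homT T X)) :
    ∀ (j : ℕ) (M : ModuleCat.{u} A), Module.Finite A M → (∀ i, j < i → ExtZero T M i) →
      ∃ U, IsEnvelope T M U
  | 0, M, hM, h => ⟨M, ModuleCat.of A PUnit, LinearMap.id, 0, hM, h,
      fun L _ i _ ↦ .of_subsingleton_left, .mk' Function.injective_id
      (fun y ↦ ⟨0, Subsingleton.elim _ _⟩) (fun _ ↦ rfl) fun y _ ↦ ⟨y, rfl⟩⟩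
  | j + 1, M, hM, h => by
    obtain ⟨J, M', ι, π, hJ, hJi, hs⟩ := hA.exists_embedding M hM
    obtain ⟨E', V', α, β, hE', hEp, hVp, hs'⟩ := hT.exists_envelope hA hfin j M' hs.finite_right
      fun i hi ↦ hs.extZero_right_right (.of_injective hJi (Nat.zero_lt_of_lt hi))
        (h (i + 1) (Nat.succ_lt_succ hi))
    obtain ⟨r, K, k, p, hk, hK⟩ := hT.exists_approx hEp (hfin E' hE')
    obtain ⟨E, a, b, hab, hE0, hEl, hEe, hEf⟩ := exists_pullback (α ∘ₗ π) p
    have hTr : Module.Finite A (ModuleCat.of A (Fin r → T)) :=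
      inferInstanceAs (Module.Finite A (Fin r → T))
    obtain ⟨m, hm, hm'⟩ := hEl ι 0 fun x ↦ by simp [hs.comp_apply]
    obtain ⟨c, hc, hc'⟩ := hEl 0 k fun x ↦ by simp [hk.comp_apply]
    have hW := isSES_of_surjective (g := β ∘ₗ p) (hs'.2.1.comp hk.2.1)
    obtain ⟨d, hd⟩ := hW.exists_lift b fun x ↦ by
      rw [LinearMap.comp_apply, ← hab]; exact hs'.comp_apply _
    refine ⟨E, _, m, d, hEf inferInstance hJ hTr,
      IsSES.rightPerp_mid (f := c) (g := a) (.mk' ?_ ?_ hc ?_) hK (.of_injective hJi),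
      hW.leftPerp_left (.of_addOf (addOf_pi T r)) hVp, .mk' ?_ ?_ ?_ ?_⟩
    · intro x y hxy
      exact hk.1 (by rw [← hc', ← hc', hxy])
    · intro x
      obtain ⟨t, ht⟩ := hk.2.1 (α (π x))
      obtain ⟨e, he, -⟩ := hEe x t ht.symm
      exact ⟨e, he⟩
    · intro e he
      obtain ⟨x, hx⟩ := hk.exists_preimage (y := b e) (by rw [← hab, he, map_zero])
      exact ⟨x, sub_eq_zero.1 (hE0 _ (by rw [map_sub, hc, he]; simp)
        (by rw [map_sub, hc', hx, sub_self]))⟩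
    · intro x y hxy
      exact hs.1 (by rw [← hm, ← hm, hxy])
    · intro w
      obtain ⟨x', hx'⟩ := hs'.exists_preimage (y := p w) w.2
      obtain ⟨x, rfl⟩ := hs.2.1 x'
      obtain ⟨e, -, he⟩ := hEe x w hx'
      exact ⟨e, hW.1 (by rw [hd]; exact he)⟩
    · intro x
      exact hW.1 (by rw [hd, hm', map_zero]; rfl)
    · intro e he
      have hb : b e = 0 := by rw [← hd, he, map_zero]
      obtain ⟨x, hx⟩ := hs.exists_preimage (y := a e)
        (hs'.1 ((hab e).trans (by rw [hb, map_zero, map_zero])))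
      exact ⟨x, sub_eq_zero.1 (hE0 _ (by rw [map_sub, hm, hx, sub_self])
        (by rw [map_sub, hm', hb]; simp))⟩

theorem IsEnvelope.horseshoe [IsNoetherianRing A] (hA : HasInjCogen A) (h : IsSES A f g)
    {U₁ U₂ : ModuleCat.{u} A} (h₁ : IsEnvelope T X U₁) (h₂ : IsEnvelope T Z U₂) :
    ∃ (U : ModuleCat.{u} A) (f' : U₁ →ₗ[A] U) (g' : U →ₗ[A] U₂),
      IsEnvelope T Y U ∧ IsSES A f' g' := by
  obtain ⟨V₁, a₁, b₁, hU₁, hp₁, hv₁, h₁⟩ := h₁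
  obtain ⟨V₂, a₂, b₂, hU₂, hp₂, hv₂, h₂⟩ := h₂
  obtain ⟨J, Q, j, π, hJ, hJi, hs⟩ := hA.exists_embedding U₁ hU₁
  obtain ⟨φ, hφ⟩ := extend_of_injective hJi h.1 (j ∘ₗ a₁)
  obtain ⟨ψ, hψ⟩ := h.exists_desc (π ∘ₗ φ) fun x ↦ by simp [hφ, hs.comp_apply]
  obtain ⟨θ, hθ⟩ := h₂.extend_of_extZero
    (hv₂ Q (hs.rightPerp_right hp₁ (.of_injective hJi)) 1 one_pos) ψ
  obtain ⟨P, a, b, hab, hP0, hPl, hPe, hPf⟩ := exists_pullback π θ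
  obtain ⟨χ, hχ, hχ'⟩ := hPl φ (a₂ ∘ₗ g) fun x ↦ by simp [hθ, hψ]
  obtain ⟨i, hi, hi'⟩ := hPl j 0 fun x ↦ by simp [hs.comp_apply]
  have hP : IsSES A i b := by
    refine .mk' (fun x y hxy ↦ hs.1 (by rw [← hi, ← hi, hxy])) (fun y ↦ ?_) hi' fun e he ↦ ?_
    · obtain ⟨x, hx⟩ := hs.2.1 (θ y)
      obtain ⟨e, -, he⟩ := hPe x y hx
      exact ⟨e, he⟩
    · obtain ⟨x, hx⟩ := hs.exists_preimage (y := a e) (by rw [hab, he, map_zero])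
      exact ⟨x, sub_eq_zero.1 (hP0 _ (by rw [map_sub, hi, hx, sub_self])
        (by rw [map_sub, hi', he]; simp))⟩
  obtain ⟨V, c, v, w, hc, hvw⟩ := h.nine hP h₁ h₂ (a := χ)
    (fun x ↦ sub_eq_zero.1 (hP0 _ (by simp [hχ, hφ, hi]) (by simp [hχ', hi', h.comp_apply])))
    hχ'
  exact ⟨P, i, b, ⟨V, χ, c, hP.finite_mid, hP.rightPerp_mid hp₁ hp₂,
    hvw.leftPerp_mid hv₁ hv₂, hc⟩, hP⟩

theorem IsEnvelope.prod {X' U U' : ModuleCat.{u} A} (h : IsEnvelope T X U)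
    (h' : IsEnvelope T X' U') :
    IsEnvelope T (ModuleCat.of A (X × X')) (ModuleCat.of A (U × U')) := by
  obtain ⟨V, f, g, hU, hp, hv, h⟩ := h
  obtain ⟨V', f', g', hU', hp', hv', h'⟩ := h'
  exact ⟨_, _, _, inferInstanceAs (Module.Finite A (U × U')), (isSES_split U U').rightPerp_mid hp hp',
    (isSES_split V V').leftPerp_mid hv hv', h.prod h'⟩

theorem IsEnvelope.equiv {X' U : ModuleCat.{u} A} (e : X ≃ₗ[A] X') (h : IsEnvelope T X U) :
    IsEnvelope T X' U := by
  obtain ⟨V, f, g, hU, hp, hv, h⟩ := h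
  exact ⟨V, _, g, hU, hp, hv, h.equiv_left e.symm⟩

theorem IsSES.homMap (h : IsSES A f g) (hX : ExtZero T X 1) :
    IsSES _ (Paper.homMap T f) (Paper.homMap T g) := by
  refine .mk' (fun p q hpq ↦ ?_) (fun p ↦ ?_) (fun p ↦ ?_) fun p hp ↦ ?_
  · exact LinearMap.ext fun t ↦ h.1 congr($hpq t)
  · obtain ⟨q, hq⟩ := h.lift_of_extZero hX p
    exact ⟨q, LinearMap.ext hq⟩
  · exact LinearMap.ext fun t ↦ h.comp_apply _
  · obtain ⟨q, hq⟩ := h.exists_lift p fun t ↦ congr($hp t)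
    exact ⟨q, LinearMap.ext hq⟩

theorem IsTilting.exists_bracket_homT [IsNoetherianRing A] (hA : HasInjCogen A) {n : ℕ}
    (hT : IsTilting T n) [Module.Finite A T]
    (hfin : ∀ X : ModuleCat.{u} A, Module.Finite A X →
      Module.Finite (Module.End A T)ᵐᵒᵖ (homT T X))
    (M : ModuleCat.{u} A) (hM : Module.Finite A M) :
    ∃ N : ModuleCat.{u} (Module.End A T)ᵐᵒᵖ, Module.Finite (Module.End A T)ᵐᵒᵖ N ∧
      ∀ (q : ℕ) (X : ModuleCat.{u} A), RightPerp T X → X ∈ bracket A M (q + 1) →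
        homT T X ∈ bracket (Module.End A T)ᵐᵒᵖ N (q + 1) := by
  obtain ⟨U₀, hU₀⟩ := hT.exists_envelope hA hfin n M hM fun i hi ↦ hT.projRes.extZero hi
  obtain ⟨-, -, -, hU₀f, -⟩ := id hU₀
  have := hfin U₀ hU₀f
  refine ⟨homT T U₀, this, fun q X hX hXM ↦ ?_⟩
  obtain ⟨X', Z, ⟨U, ⟨V, f, g, hU, hUp, hV, hs⟩, ⟨e⟩⟩, hZ⟩ :=
    bracket_transfer (M := M) (N := homT T U₀)
    (fun X Z ↦ ∃ U, IsEnvelope T X U ∧ Nonempty (homT T U ≃ₗ[(Module.End A T)ᵐᵒᵖ] Z))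
    (fun e ⟨U, hU, he⟩ ↦ ⟨U, hU.equiv e, he⟩)
    (fun r ↦ pi_mem (M := fun _ ↦ M) (Q := {X | ∃ Z ∈ addOf _ (homT T U₀), ∃ U,
        IsEnvelope T X U ∧ Nonempty (homT T U ≃ₗ[(Module.End A T)ᵐᵒᵖ] Z)})
      (fun e ⟨Z, hZ, U, hU, he⟩ ↦ ⟨Z, hZ, U, hU.equiv e, he⟩)
      (fun X _ ↦ ⟨homT T X, memAdd.of_subsingleton, X, ⟨X, LinearMap.id, LinearMap.id,
        inferInstance, fun _ _ ↦ .of_subsingleton_right, fun _ _ _ _ ↦ .of_subsingleton_left,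
        .mk' Function.injective_id Function.surjective_id (fun _ ↦ Subsingleton.elim _ _)
          fun y _ ↦ ⟨y, rfl⟩⟩, ⟨.refl _ _⟩⟩)
      (fun X Y ⟨Z, hZ, U, hU, ⟨e⟩⟩ ⟨Z', hZ', U', hU', ⟨e'⟩⟩ ↦
        ⟨_, hZ.prod hZ', _, hU.prod hU', ⟨(homTProd T U U').trans (.prodCongr e e')⟩⟩)
      fun _ ↦ ⟨_, addOf_self _, U₀, hU₀, ⟨.refl _ _⟩⟩)
    (fun h ⟨U₁, h₁, ⟨e₁⟩⟩ ⟨U₂, h₂, ⟨e₂⟩⟩ ↦ by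
      obtain ⟨U, f', g', hU, hs⟩ := IsEnvelope.horseshoe hA h h₁ h₂
      obtain ⟨-, -, -, -, hp₁, -⟩ := h₁
      exact ⟨_, _, _, ⟨U, hU, ⟨.refl _ _⟩⟩,
        ((hs.homMap (hp₁ 1 one_pos)).equiv_left e₁.symm).equiv_right e₂⟩) hXM
  refine bracket_retract hZ (.trans (homT_retract ?_) (.of_equiv e))
  obtain ⟨r, hr⟩ := hs.extend_of_extZero (hV X hX 1 one_pos) (LinearMap.fst A X X')
  exact ⟨f ∘ₗ LinearMap.inl A X X', r, LinearMap.ext fun x ↦ hr (x, 0)⟩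

end Perp

section Presentation

variable {A : Type u} [Ring A] {T : ModuleCat.{u} A}

/-- A complex `⋯ → T^{r 1} → T^{r 0}` which is a projective resolution of `Y` after applying
`Hom_A(T, -)`. -/
structure IsHomRes (T : ModuleCat.{u} A) (r : ℕ → ℕ)
    (d : ∀ i, ModuleCat.of A (Fin (r (i + 1)) → T) →ₗ[A] ModuleCat.of A (Fin (r i) → T)) :
    Prop where
  range_eq (i : ℕ) : LinearMap.range (homMap T (d (i + 1))) = LinearMap.ker (homMap T (d i))

/-- A map between finite powers of `T`. -/
structure PowMap (T : ModuleCat.{u} A) where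
  /-- The exponent of the source. -/
  src : ℕ
  /-- The exponent of the target. -/
  tgt : ℕ
  /-- The map. -/
  map : ModuleCat.of A (Fin src → T) →ₗ[A] ModuleCat.of A (Fin tgt → T)

theorem finite_homT_pow (T : ModuleCat.{u} A) (r : ℕ) :
    Module.Finite (Module.End A T)ᵐᵒᵖ (homT T (ModuleCat.of A (Fin r → T))) :=
  Module.Finite.equiv (homTPow T r).symm

theorem exists_isHomRes [IsNoetherianRing (Module.End A T)ᵐᵒᵖ]
    (Y : ModuleCat.{u} (Module.End A T)ᵐᵒᵖ) (hY : Module.Finite (Module.End A T)ᵐᵒᵖ Y) :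
    ∃ (r : ℕ → ℕ)
      (d : ∀ i, ModuleCat.of A (Fin (r (i + 1)) → T) →ₗ[A] ModuleCat.of A (Fin (r i) → T))
      (ε : homT T (ModuleCat.of A (Fin (r 0) → T)) →ₗ[(Module.End A T)ᵐᵒᵖ] Y),
      IsHomRes T r d ∧ Function.Surjective ε ∧
        LinearMap.range (homMap T (d 0)) = LinearMap.ker ε := by
  obtain ⟨r₀, ε, hε⟩ := Module.Finite.exists_fin' (Module.End A T)ᵐᵒᵖ Y
  have hfg (r : ℕ) (K : Submodule (Module.End A T)ᵐᵒᵖ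
      (homT T (ModuleCat.of A (Fin r → T)))) : K.FG := by
    have := finite_homT_pow T r
    exact IsNoetherian.noetherian K
  obtain ⟨r₁, d₀, hd₀⟩ := exists_range_homMap
    (LinearMap.ker (ε ∘ₗ (homTPow T r₀).toLinearMap)) (hfg r₀ _)
  choose r' d' hd' using fun p : PowMap T ↦
    exists_range_homMap (LinearMap.ker (homMap T p.map)) (hfg p.src _)
  let seq : ℕ → PowMap T := fun i ↦ Nat.rec ⟨r₁, r₀, d₀⟩ (fun _ p ↦ ⟨r' p, p.src, d' p⟩) i
  exact ⟨fun i ↦ (seq i).tgt, fun i ↦ (seq i).map, ε ∘ₗ (homTPow T r₀).toLinearMap,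
    ⟨fun i ↦ hd' (seq i)⟩, hε.comp (homTPow T r₀).surjective, hd₀⟩

variable {r : ℕ → ℕ}
  {d : ∀ i, ModuleCat.of A (Fin (r (i + 1)) → T) →ₗ[A] ModuleCat.of A (Fin (r i) → T)}

theorem IsHomRes.comp_apply (hd : IsHomRes T r d) (i : ℕ)
    (v : ModuleCat.of A (Fin (r (i + 2)) → T)) : d i (d (i + 1) v) = 0 := by
  have h : d i ∘ₗ d (i + 1) = 0 := by
    refine LinearMap.pi_ext' fun j ↦ ?_
    have : homMap T (d (i + 1)) (LinearMap.single A (fun _ ↦ T) j) ∈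
        LinearMap.ker (homMap T (d i)) := (hd.range_eq i) ▸ ⟨_, rfl⟩
    exact this
  exact congr($h v)

theorem IsHomRes.lift_addOf (hd : IsHomRes T r d) {V : ModuleCat.{u} A} (hV : V ∈ addOf A T)
    (i : ℕ) (h : V →ₗ[A] ModuleCat.of A (Fin (r (i + 1)) → T)) (hh : ∀ v, d i (h v) = 0) :
    ∃ h' : V →ₗ[A] ModuleCat.of A (Fin (r (i + 2)) → T), ∀ v, d (i + 1) (h' v) = h v := by
  obtain ⟨m, s, p, hsp⟩ := mem_addOf_iff.1 hV
  have key (j : Fin m) : ∃ q : T →ₗ[A] ModuleCat.of A (Fin (r (i + 2)) → T),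
      d (i + 1) ∘ₗ q = (h ∘ₗ p) ∘ₗ LinearMap.single A (fun _ ↦ T) j := by
    have : ((h ∘ₗ p) ∘ₗ LinearMap.single A (fun _ ↦ T) j :) ∈
        LinearMap.range (homMap T (d (i + 1))) := by
      rw [hd.range_eq]
      exact LinearMap.ext fun t ↦ hh _
    exact this
  choose q hq using key
  refine ⟨(LinearMap.lsum A (fun _ ↦ T) ℕ q) ∘ₗ s, fun v ↦ ?_⟩
  have : d (i + 1) ∘ₗ LinearMap.lsum A (fun _ ↦ T) ℕ q = h ∘ₗ p := by
    refine LinearMap.pi_ext' fun j ↦ ?_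
    rw [← hq]
    refine LinearMap.ext fun t ↦ congrArg (d (i + 1)) ?_
    simp only [LinearMap.comp_apply, LinearMap.lsum_apply, LinearMap.sum_apply]
    rw [Finset.sum_eq_single j] <;> simp +contextual
  exact (congr($this (s v))).trans congr(h ($hsp v))

theorem IsHomRes.isSES_quotient (hd : IsHomRes T r d) (i : ℕ) :
    ∃ f : ModuleCat.of (Module.End A T)ᵐᵒᵖ (homT T (ModuleCat.of A (Fin (r (i + 1)) → T)) ⧸
        LinearMap.range (homMap T (d (i + 1)))) →ₗ[(Module.End A T)ᵐᵒᵖ]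
          homT T (ModuleCat.of A (Fin (r i) → T)),
      IsSES _ (Z := ModuleCat.of (Module.End A T)ᵐᵒᵖ
        (homT T (ModuleCat.of A (Fin (r i) → T)) ⧸ LinearMap.range (homMap T (d i)))) f
        (Submodule.mkQ _) := by
  refine ⟨Submodule.liftQ _ (homMap T (d i)) (hd.range_eq i).le, ?_, Submodule.mkQ_surjective _, ?_⟩
  · exact LinearMap.ker_eq_bot.1 (Submodule.ker_liftQ_eq_bot _ _ _ (hd.range_eq i).ge)
  · exact (Submodule.range_liftQ _ _ _).trans (Submodule.ker_mkQ _).symm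

variable [HasExt.{u} (ModuleCat.{u} A)] {n : ℕ}

theorem IsHomRes.lift_coresBy (hT : IsTilting T n) (hd : IsHomRes T r d) :
    ∀ {j : ℕ} {V : ModuleCat.{u} A}, CoresBy A T V j → ∀ i, j ≤ i →
    ∀ h : V →ₗ[A] ModuleCat.of A (Fin (r (i + 1)) → T), (∀ v, d i (h v) = 0) →
    ∃ h' : V →ₗ[A] ModuleCat.of A (Fin (r (i + 2)) → T), ∀ v, d (i + 1) (h' v) = h v
  | 0, _, hV, i, _, h, hh => hd.lift_addOf hV i h hh
  | j + 1, _, ⟨T₀, ι, hT₀, hι, hV⟩, i + 1, hi, h, hh => by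
    have hs := isSES_of_injective hι
    obtain ⟨k, hk⟩ := hs.extend_of_extZero
      (LeftPerp.of_coresBy hV _ (hT.rightPerp_addOf (addOf_pi T (r (i + 2)))) 1 one_pos) h
    obtain ⟨k', hk'⟩ := hs.exists_desc (d (i + 1) ∘ₗ k) fun x ↦ by
      rw [LinearMap.comp_apply, hk, hh]
    obtain ⟨l, hl⟩ := IsHomRes.lift_coresBy hT hd hV i (Nat.le_of_succ_le_succ hi) k' fun v ↦ by
      obtain ⟨v, rfl⟩ := hs.2.1 v
      rw [hk', LinearMap.comp_apply, hd.comp_apply]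
    obtain ⟨m, hm⟩ := hd.lift_addOf hT₀ (i + 1) (k - l ∘ₗ Submodule.mkQ _) fun v ↦ by
      rw [LinearMap.sub_apply, map_sub, LinearMap.comp_apply, hl, hk', LinearMap.comp_apply,
        sub_self]
    refine ⟨m ∘ₗ ι, fun v ↦ ?_⟩
    rw [LinearMap.comp_apply, hm, LinearMap.sub_apply, LinearMap.comp_apply, hs.comp_apply,
      map_zero, sub_zero, hk]

theorem IsHomRes.isSES_range (hT : IsTilting T n) (hd : IsHomRes T r d) {i : ℕ} (hi : n ≤ i) :
    IsSES A (X := ModuleCat.of A (LinearMap.range (d (i + 1))))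
      (Z := ModuleCat.of A (LinearMap.range (d i))) (LinearMap.range (d (i + 1))).subtype
      (d i).rangeRestrict := by
  refine .mk' (Submodule.subtype_injective _) (LinearMap.surjective_rangeRestrict _) ?_ ?_
  · rintro ⟨-, v, rfl⟩
    exact Subtype.ext (hd.comp_apply i v)
  · intro y hy
    have hy' : d i y = 0 := congr(($hy).1)
    obtain ⟨h', hh⟩ := hd.lift_coresBy hT hT.cores i hi (LinearMap.toSpanSingleton A _ y)
      fun v ↦ by rw [LinearMap.toSpanSingleton_apply, map_smul, hy', smul_zero]
    exact ⟨⟨y, h' (1 : A), by rw [hh, LinearMap.toSpanSingleton_apply, one_smul]⟩, rfl⟩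

theorem IsHomRes.rightPerp_range (hT : IsTilting T n) (hd : IsHomRes T r d) {i : ℕ}
    (hi : n ≤ i) : RightPerp T (ModuleCat.of A (LinearMap.range (d i))) := by
  have key (t : ℕ) : ∀ (m i : ℕ), n ≤ i → 0 < m → n < m + t →
      ExtZero T (ModuleCat.of A (LinearMap.range (d i))) m := by
    induction t with
    | zero => exact fun m i _ _ h ↦ hT.projRes.extZero h
    | succ t ih =>
      intro m i hi hm h
      exact (hd.isSES_range hT hi).extZero_right_right (hT.rightPerp_addOf (addOf_pi T _) m hm)
        (ih (m + 1) (i + 1) (by omega) (by omega) (by omega))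
  exact fun m hm ↦ key n m i hi hm (by omega)

theorem IsHomRes.exists_homT (hT : IsTilting T n) (hd : IsHomRes T r d) [Module.Finite A T] :
    ∃ X : ModuleCat.{u} A, Module.Finite A X ∧ RightPerp T X ∧
      Nonempty (homT T X ≃ₗ[(Module.End A T)ᵐᵒᵖ]
        (homT T (ModuleCat.of A (Fin (r n) → T)) ⧸ LinearMap.range (homMap T (d n)))) := by
  have hs := isSES_of_injective (X := ModuleCat.of A (LinearMap.range (d n)))
    (Submodule.subtype_injective (LinearMap.range (d n)))
  have hp := hd.rightPerp_range hT le_rfl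
  have hTn : Module.Finite A (ModuleCat.of A (Fin (r n) → T)) :=
    inferInstanceAs (Module.Finite A (Fin (r n) → T))
  refine ⟨_, hs.finite_right, hs.rightPerp_right hp (hT.rightPerp_addOf (addOf_pi T _)), ?_⟩
  have hh := hs.homMap (hp 1 one_pos)
  refine ⟨((Submodule.quotEquivOfEq _ _ ?_).trans
    ((homMap T _).quotKerEquivOfSurjective hh.2.1)).symm⟩
  rw [← hh.2.2]
  refine le_antisymm ?_ ?_
  · rintro _ ⟨h, rfl⟩
    exact ⟨(d n).rangeRestrict ∘ₗ h, rfl⟩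
  · rintro _ ⟨h, rfl⟩
    obtain ⟨q, hq⟩ := (hd.isSES_range hT le_rfl).lift_of_extZero
      (hd.rightPerp_range hT n.le_succ 1 one_pos) h
    exact ⟨q, LinearMap.ext fun t ↦ congr(($(hq t)).1)⟩

end Presentation

theorem exists_bracket_iterated_cosyzygy {C : Type u} [Ring C] [IsNoetherianRing C]
    (hC : HasInjCogen C) : ∀ (n : ℕ) (N : ModuleCat.{u} C), Module.Finite C N →
    ∃ N' : ModuleCat.{u} C, Module.Finite C N' ∧
      ∀ (q : ℕ) (Y P : ℕ → ModuleCat.{u} C), (∀ i, P i ∈ addOf C (ModuleCat.of C C)) →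
        (∀ i, ∃ (f : Y (i + 1) →ₗ[C] P i) (g : P i →ₗ[C] Y i), IsSES C f g) →
        Y n ∈ bracket C N (q + 1) → Y 0 ∈ bracket C N' (q + n + 1)
  | 0, N, hN => ⟨N, hN, fun _ _ _ _ _ h ↦ h⟩
  | n + 1, N, hN => by
    obtain ⟨N₁, hN₁, h₁⟩ := exists_bracket_cosyzygy hC N hN
    obtain ⟨N', hN', h'⟩ := exists_bracket_iterated_cosyzygy hC n N₁ hN₁
    refine ⟨N', hN', fun q Y P hP hs hY ↦ ?_⟩
    obtain ⟨f, g, hfg⟩ := hs n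
    rw [show q + (n + 1) + 1 = q + 1 + n + 1 by omega]
    exact h' (q + 1) Y P hP hs (h₁ q _ _ _ f g hfg (hP n) hY)

theorem IsTilting.extDim_le {A : Type u} [Ring A] [HasExt.{u} (ModuleCat.{u} A)]
    {T : ModuleCat.{u} A} {n : ℕ} (hT : IsTilting T n) [Module.Finite A T] [IsNoetherianRing A]
    [IsNoetherianRing (Module.End A T)ᵐᵒᵖ] (hA : HasInjCogen A)
    (hC : HasInjCogen (Module.End A T)ᵐᵒᵖ)
    (hfin : ∀ X : ModuleCat.{u} A, Module.Finite A X →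
      Module.Finite (Module.End A T)ᵐᵒᵖ (homT T X)) :
    extDim (Module.End A T)ᵐᵒᵖ ≤ extDim A + n := by
  refine extDim_le_of fun m M hM hX ↦ ?_
  obtain ⟨N, hN, hNX⟩ := hT.exists_bracket_homT hA hfin M hM
  obtain ⟨N', hN', h'⟩ := exists_bracket_iterated_cosyzygy hC n N hN
  refine ⟨N', hN', fun Y hY ↦ ?_⟩
  obtain ⟨r, d, ε, hd, hε, h0⟩ := exists_isHomRes Y hY
  obtain ⟨X, hXf, hXp, ⟨e⟩⟩ := hd.exists_homT hT
  refine bracket_equiv (h' m (fun i ↦ ModuleCat.of _ (homT T (ModuleCat.of A (Fin (r i) → T)) ⧸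
    LinearMap.range (homMap T (d i)))) (fun i ↦ homT T (ModuleCat.of A (Fin (r i) → T)))
    (fun i ↦ homT_addOf (addOf_pi T _)) (fun i ↦ ?_)
    (bracket_equiv (hNX m X hXp (hX X hXf)) e)) ?_
  · obtain ⟨f, hf⟩ := hd.isSES_quotient i
    exact ⟨f, _, hf⟩
  · exact (Submodule.quotEquivOfEq _ _ h0).trans (ε.quotKerEquivOfSurjective hε)

section Dual

variable {A : Type u} [Ring A] (R : Type u) [Ring R] (I : Type u) [AddCommGroup I] [Module A I]
  [Module R I] [SMulCommClass A R I]

/-- `Hom_A(X, I)` for an `A`-`R`-bimodule `I`. -/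
abbrev dual (X : ModuleCat.{u} A) : ModuleCat.{u} R := ModuleCat.of R (X →ₗ[A] I)

variable {X Y Z : ModuleCat.{u} A} {f : X →ₗ[A] Y} {g : Y →ₗ[A] Z}

/-- Precomposition with `f`. -/
def dualMap (f : X →ₗ[A] Y) : dual R I Y →ₗ[R] dual R I X where
  toFun h := (h : Y →ₗ[A] I) ∘ₗ f
  map_add' _ _ := rfl
  map_smul' _ _ := rfl

variable {R I}

theorem IsRetract.dual (h : IsRetract X Y) : IsRetract (dual R I X) (dual R I Y) := by
  obtain ⟨s, r, hrs⟩ := h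
  exact ⟨dualMap R I r, dualMap R I s, LinearMap.ext fun h ↦ LinearMap.ext fun x ↦
    congr((h : X →ₗ[A] I) ($hrs x))⟩

/-- `Hom_A(-, I)` turns finite powers into finite powers. -/
def dualPow (R I : Type u) [Ring R] [AddCommGroup I] [Module A I] [Module R I]
    [SMulCommClass A R I] (X : ModuleCat.{u} A) (r : ℕ) :
    dual R I (ModuleCat.of A (Fin r → X)) ≃ₗ[R] (Fin r → dual R I X) :=
  (LinearMap.lsum A (fun _ : Fin r ↦ X) R (M := I)).symm

theorem dual_addOf {M : ModuleCat.{u} A} (hX : X ∈ addOf A M) :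
    dual R I X ∈ addOf R (dual R I M) := by
  obtain ⟨r, h⟩ := mem_addOf_iff.1 hX
  exact mem_addOf_iff.2 ⟨r, h.dual.trans (.of_equiv (dualPow R I M r))⟩

theorem IsSES.dual (h : IsSES A f g) (hI : ∀ p : X →ₗ[A] I, ∃ q : Y →ₗ[A] I, ∀ x, q (f x) = p x) :
    IsSES R (dualMap R I g) (dualMap R I f) := by
  refine .mk' (fun p q hpq ↦ LinearMap.ext fun z ↦ ?_) (fun p ↦ ?_) (fun p ↦ ?_) fun p hp ↦ ?_
  · obtain ⟨y, rfl⟩ := h.2.1 z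
    exact congr((show Y →ₗ[A] I from $hpq) y)
  · obtain ⟨q, hq⟩ := hI p
    exact ⟨q, LinearMap.ext hq⟩
  · exact LinearMap.ext fun x ↦ (congrArg (p : Z →ₗ[A] I) (h.comp_apply x)).trans
      (map_zero (p : Z →ₗ[A] I))
  · obtain ⟨q, hq⟩ := h.exists_desc (L := ModuleCat.of A I) (p : Y →ₗ[A] I)
      fun x ↦ congr((show X →ₗ[A] I from $hp) x)
    exact ⟨q, LinearMap.ext hq⟩

variable [SMulCommClass R A I]

variable (R I) in
/-- The evaluation map to the double dual. -/
def evalDual (X : ModuleCat.{u} A) : X →ₗ[A] dual A I (dual R I X) where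
  toFun x :=
    { toFun := fun h ↦ (h : X →ₗ[A] I) x
      map_add' := fun _ _ ↦ rfl
      map_smul' := fun _ _ ↦ rfl }
  map_add' x y := LinearMap.ext fun h ↦ map_add (h : X →ₗ[A] I) x y
  map_smul' a x := LinearMap.ext fun h ↦ map_smul (h : X →ₗ[A] I) a x

end Dual

section Assoc

variable {A : Type u} [Ring A]

theorem bracket_of_ses' {T : ModuleCat.{u} A} [Module.Finite A T] :
    ∀ {q : ℕ} {X W M : ModuleCat.{u} A} {f : X →ₗ[A] W} {g : W →ₗ[A] M}, IsSES A f g →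
      X ∈ bracket A T (q + 1) → M ∈ addOf A T → W ∈ bracket A T (q + 2)
  | 0, X, W, M, f, g, h, hX, hM => by
    have := finite_of_mem_addOf hX
    have := finite_of_mem_addOf hM
    exact bracket_of_ses h h.finite_mid hX hM
  | q + 1, X, W, M, f, g, h, hX, hM => by
    obtain ⟨M₁, W₁, X₂, a, b, hr, hW₁, hM₁, hX₂, hs⟩ := exists_ses_of_mem_bracket hX
    obtain ⟨X', ⟨e⟩⟩ := hr.exists_compl
    have hid : IsSES A (X := X') (Y := X') (Z := ModuleCat.of A PUnit) LinearMap.id 0 :=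
      .mk' Function.injective_id (fun y ↦ ⟨0, Subsingleton.elim _ _⟩) (fun _ ↦ rfl)
        fun y _ ↦ ⟨y, rfl⟩
    have h' := ((h.prod hid).equiv_left e.symm).equiv_right (Z' := M) (LinearEquiv.prodUnique)
    obtain ⟨i, p, hip⟩ : ∃ (i : W₁ →ₗ[A] ModuleCat.of A (W × X'))
      (p : ModuleCat.of A (W × X') →ₗ[A] M), IsSES A i p := ⟨_, _, h'⟩
    have hq := isSES_of_injective (f := i ∘ₗ a) (hip.1.comp hs.1)
    obtain ⟨v, hv⟩ := hs.exists_desc (L := ModuleCat.of A (ModuleCat.of A (W × X') ⧸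
      LinearMap.range (i ∘ₗ a))) (Submodule.mkQ _ ∘ₗ i) fun x ↦ hq.comp_apply x
    obtain ⟨w, hw⟩ := hq.exists_desc p fun x ↦ hip.comp_apply _
    have hvw : IsSES A v w := by
      refine .mk' ?_ ?_ ?_ ?_
      · rw [injective_iff_map_eq_zero]
        intro x hx
        obtain ⟨x, rfl⟩ := hs.2.1 x
        rw [hv] at hx
        obtain ⟨m, hm⟩ := hq.exists_preimage hx
        rw [← hip.1 hm, hs.comp_apply]
      · intro m
        obtain ⟨x, rfl⟩ := hip.2.1 m
        exact ⟨_, hw x⟩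
      · intro x
        obtain ⟨x, rfl⟩ := hs.2.1 x
        rw [hv]
        exact (hw _).trans (hip.comp_apply x)
      · intro y hy
        obtain ⟨y, rfl⟩ := hq.2.1 y
        obtain ⟨x, rfl⟩ := hip.exists_preimage ((hw y).symm.trans hy)
        exact ⟨b x, hv x⟩
    have hQ := bracket_of_ses' hvw hX₂ hM
    have := finite_of_mem_bracket hQ
    have := finite_of_mem_addOf hM₁
    exact bracket_retract (bracket_of_ses hq hq.finite_mid hM₁ hQ) (.fst W X')

end Assoc

section Duality

variable {A R I : Type u} [Ring A] [Ring R] [AddCommGroup I] [Module A I]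
  [Module R I] [SMulCommClass A R I]

theorem bracket_dual (hI : Module.Injective A I) {M : ModuleCat.{u} A}
    [Module.Finite R (dual R I M)] :
    ∀ {q : ℕ} {X : ModuleCat.{u} A}, X ∈ bracket A M (q + 1) →
      dual R I X ∈ bracket R (dual R I M) (q + 1)
  | 0, _, hX => dual_addOf hX
  | q + 1, _, hX => by
    obtain ⟨M₁, W, Y, f, g, hr, hW, hM, hY, hs⟩ := exists_ses_of_mem_bracket hX
    exact bracket_retract (bracket_of_ses' (hs.dual fun p ↦ hI.out _ hs.1 p) (bracket_dual hI hY)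
      (dual_addOf hM)) hr.dual

variable [SMulCommClass R A I]

variable (A R I) in

/-- One half of a Morita duality between `A` and `R` defined by the bimodule `I`. -/
structure IsHalfDuality : Prop where
  inj : Module.Injective A I
  fin (X : ModuleCat.{u} A) (hX : Module.Finite A X) : Module.Finite R (X →ₗ[A] I)
  bij (X : ModuleCat.{u} A) (hX : Module.Finite A X) : Function.Bijective (evalDual R I X)

theorem IsHalfDuality.extDim_le (h : IsHalfDuality A R I) (h' : IsHalfDuality R A I) :
    extDim A ≤ extDim R := by
  suffices extDim A ≤ extDim R + (0 : ℕ) by simpa using this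
  refine extDim_le_of fun m M hM hX ↦ ?_
  have hfin : Module.Finite A (dual A I M) := h'.fin M hM
  exact ⟨dual A I M, hfin, fun Y hY ↦ bracket_equiv (bracket_dual h'.inj (hX _ (h.fin Y hY)))
    (LinearEquiv.ofBijective _ (h.bij Y hY)).symm⟩

theorem IsHalfDuality.hasInjCogen (h : IsHalfDuality A R I) (h' : IsHalfDuality R A I) :
    HasInjCogen A := by
  refine ⟨ModuleCat.of A I, ?_, h.inj, fun X hX ↦ ?_⟩
  · have := h'.fin (ModuleCat.of R R) (inferInstanceAs (Module.Finite R R))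
    exact Module.Finite.equiv (LinearMap.ringLmapEquivSelf R A I)
  · have := h.fin X hX
    obtain ⟨r, s, hs⟩ := Submodule.fg_iff_exists_fin_generating_family.1
      (Module.Finite.fg_top (R := R) (M := X →ₗ[A] I))
    refine ⟨r, LinearMap.pi s, (injective_iff_map_eq_zero _).2 fun x hx ↦
      (injective_iff_map_eq_zero _).1 (h.bij X hX).1 x ?_⟩
    refine LinearMap.ext_on_range hs fun i ↦ ?_
    exact congr($hx i)

end Duality

section Algebra

variable {k : Type u} [CommRing k] {E : Type u} [AddCommGroup E] [Module k E]
  {A R I : Type u} [Ring A] [Algebra k A] [Ring R] [Algebra k R] [AddCommGroup I]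
  [Module k I] [Module A I] [Module R I]

/-- The bimodule `I` with the functional `τ` represents the functor `Hom_k(-, E)`. -/
def Represents (A : Type u) [Ring A] [Algebra k A] [Module A I] (τ : I →ₗ[k] E) : Prop :=
  ∀ (X : Type u) [AddCommGroup X] [Module A X] [Module k X] [IsScalarTower k A X] (g : X →ₗ[k] E),
    ∃! f : X →ₗ[A] I, ∀ x, τ (f x) = g x

theorem Represents.isHalfDuality [Module.Finite k A] [IsScalarTower k A I] [IsScalarTower k R I]
    [SMulCommClass A R I] [SMulCommClass R A I] (hE : IsDualizing k E) {τ : I →ₗ[k] E}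
    (hA : Represents A τ) (hR : Represents R τ) : IsHalfDuality A R I := by
  have hkX (X : ModuleCat.{u} A) : ∃ _ : Module k X, IsScalarTower k A X :=
    letI := Module.compHom X (algebraMap k A)
    ⟨inferInstance, ⟨fun c a x ↦ by rw [Algebra.smul_def, mul_smul]; rfl⟩⟩
  have hbij (X : Type u) [AddCommGroup X] [Module A X] [Module k X] [IsScalarTower k A X] :
      ∃ e : (X →ₗ[A] I) ≃ₗ[k] (X →ₗ[k] E), ∀ f x, e f x = τ (f x) := by
    refine ⟨.ofBijective
      { toFun := fun f ↦ τ ∘ₗ f.restrictScalars k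
        map_add' := fun _ _ ↦ LinearMap.ext fun _ ↦ map_add τ _ _
        map_smul' := fun _ _ ↦ LinearMap.ext fun _ ↦ map_smul τ _ _ } ⟨?_, ?_⟩, fun _ _ ↦ rfl⟩
    · intro f f' h
      exact (hA X (τ ∘ₗ f.restrictScalars k)).unique (fun _ ↦ rfl) fun x ↦ congr($h.symm x)
    · intro g
      obtain ⟨f, hf, -⟩ := hA X g
      exact ⟨f, LinearMap.ext hf⟩
  refine ⟨⟨fun X Y _ _ _ _ i hi p ↦ ?_⟩, fun X hX ↦ ?_, fun X hX ↦ ?_⟩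
  · obtain ⟨_, _⟩ := hkX (ModuleCat.of A X)
    obtain ⟨_, _⟩ := hkX (ModuleCat.of A Y)
    obtain ⟨g, hg⟩ := hE.1.out (i.restrictScalars k) hi (τ ∘ₗ p.restrictScalars k)
    obtain ⟨f, hf, -⟩ := hA Y g
    refine ⟨f, fun x ↦ congr($((hA X (τ ∘ₗ p.restrictScalars k)).unique
      (y₁ := f ∘ₗ i) (y₂ := p) (fun x ↦ ?_) fun _ ↦ rfl) x)⟩
    exact (hf _).trans (hg x)
  · obtain ⟨_, _⟩ := hkX X
    have : Module.Finite k X := .trans A X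
    obtain ⟨e, -⟩ := hbij X
    have := (hE.2 X).1
    have := Module.Finite.equiv e.symm
    exact Module.Finite.of_restrictScalars_finite k R _
  · obtain ⟨_, _⟩ := hkX X
    have : Module.Finite k X := .trans A X
    obtain ⟨e, he⟩ := hbij X
    obtain ⟨-, hinj, hsurj⟩ := hE.2 X
    refine ⟨(injective_iff_map_eq_zero _).2 fun x hx ↦ ?_, fun ξ ↦ ?_⟩
    · refine (injective_iff_map_eq_zero _).1 hinj x (LinearMap.ext fun g ↦ ?_)
      obtain ⟨f, rfl⟩ := e.surjective g
      refine (he f x).trans ?_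
      rw [show f x = 0 from congr((show (X →ₗ[A] I) →ₗ[R] I from $hx) f), map_zero]
      rfl
    · let ξ' : (X →ₗ[A] I) →ₗ[R] I := ξ
      obtain ⟨x, hx⟩ := hsurj (τ ∘ₗ ξ'.restrictScalars k ∘ₗ e.symm.toLinearMap)
      refine ⟨x, (hR (X →ₗ[A] I) (τ ∘ₗ ξ'.restrictScalars k)).unique (fun f ↦ ?_) fun _ ↦ rfl⟩
      have := congr($hx (e f))
      simp only [LinearMap.applyₗ_apply_apply, LinearMap.comp_apply, LinearEquiv.coe_coe,
        LinearEquiv.symm_apply_apply, he] at this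
      exact this

theorem exists_duality (k : Type u) [CommRing k] [IsArtinianRing k] {A R : Type u} [Ring A]
    [Algebra k A] [Ring R] [Algebra k R] [Module.Finite k A] [Module.Finite k R]
    (φ : R ≃ₐ[k] Aᵐᵒᵖ) :
    ∃ (I : Type u) (_ : AddCommGroup I) (_ : Module A I) (_ : Module R I)
      (_ : SMulCommClass A R I) (_ : SMulCommClass R A I),
      IsHalfDuality A R I ∧ IsHalfDuality R A I := by
  obtain ⟨E, _, _, hE⟩ := exists_isDualizing k
  let _ : Module A (A →ₗ[k] E) :=
    { smul := fun a f ↦ f ∘ₗ LinearMap.mulRight k a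
      one_smul := fun f ↦ LinearMap.ext fun b ↦ congrArg f (mul_one b)
      mul_smul := fun a a' f ↦ LinearMap.ext fun b ↦ congrArg f (mul_assoc b a a').symm
      smul_zero := fun _ ↦ rfl
      smul_add := fun _ _ _ ↦ rfl
      add_smul := fun a a' f ↦ LinearMap.ext fun b ↦
        (congrArg f (mul_add b a a')).trans (map_add f _ _)
      zero_smul := fun f ↦ LinearMap.ext fun b ↦ (congrArg f (mul_zero b)).trans (map_zero f) }
  let _ : Module R (A →ₗ[k] E) :=
    { smul := fun r f ↦ f ∘ₗ LinearMap.mulLeft k (φ r).unop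
      one_smul := fun f ↦ LinearMap.ext fun b ↦ congrArg f (by simp)
      mul_smul := fun r s f ↦ LinearMap.ext fun b ↦ congrArg f (by simp)
      smul_zero := fun _ ↦ rfl
      smul_add := fun _ _ _ ↦ rfl
      add_smul := fun r s f ↦ LinearMap.ext fun b ↦
        (congrArg f (by simp [add_mul])).trans (map_add f _ _)
      zero_smul := fun f ↦ LinearMap.ext fun b ↦ (congrArg f (by simp)).trans (map_zero f) }
  have hA (a b : A) (f : A →ₗ[k] E) : (a • f) b = f (b * a) := rfl
  have hR (r : R) (b : A) (f : A →ₗ[k] E) : (r • f) b = f ((φ r).unop * b) := rfl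
  have : IsScalarTower k A (A →ₗ[k] E) := ⟨fun c a f ↦ LinearMap.ext fun b ↦ by
    rw [hA, LinearMap.smul_apply, hA, mul_smul_comm, map_smul]⟩
  have : IsScalarTower k R (A →ₗ[k] E) := ⟨fun c r f ↦ LinearMap.ext fun b ↦ by
    rw [hR, LinearMap.smul_apply, hR, map_smul, MulOpposite.unop_smul, smul_mul_assoc, map_smul]⟩
  have : SMulCommClass A R (A →ₗ[k] E) := ⟨fun a r f ↦ LinearMap.ext fun b ↦ by
    rw [hA, hR, hR, hA, mul_assoc]⟩
  have : SMulCommClass R A (A →ₗ[k] E) := ⟨fun r a f ↦ (smul_comm a r f).symm⟩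
  let τ : (A →ₗ[k] E) →ₗ[k] E := LinearMap.applyₗ (1 : A)
  have hτ (f : A →ₗ[k] E) : τ f = f 1 := rfl
  have rA : Represents A τ := by
    intro X _ _ _ _ g
    refine ⟨{ toFun := fun x ↦ g ∘ₗ (LinearMap.toSpanSingleton A X x).restrictScalars k
              map_add' := fun x y ↦ LinearMap.ext fun b ↦ by simp
              map_smul' := fun a x ↦ LinearMap.ext fun b ↦ ?_ }, fun x ↦ ?_, fun f hf ↦ ?_⟩
    · simp [hA, mul_smul]
    · simp [hτ]
    · refine LinearMap.ext fun x ↦ LinearMap.ext fun b ↦ ?_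
      simp [← hf, hτ, hA]
  have rR : Represents R τ := by
    intro X _ _ _ _ g
    refine ⟨{ toFun := fun x ↦ g ∘ₗ (LinearMap.toSpanSingleton R X x).restrictScalars k ∘ₗ
                φ.symm.toLinearMap ∘ₗ (MulOpposite.opLinearEquiv k).toLinearMap
              map_add' := fun x y ↦ LinearMap.ext fun b ↦ by simp
              map_smul' := fun a x ↦ LinearMap.ext fun b ↦ ?_ }, fun x ↦ ?_, fun f hf ↦ ?_⟩
    · simp [hR, mul_smul]
    · simp [hτ]
    · refine LinearMap.ext fun x ↦ LinearMap.ext fun b ↦ ?_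
      simp [← hf, hτ, hR]
  exact ⟨A →ₗ[k] E, inferInstance, inferInstance, inferInstance, inferInstance, inferInstance,
    rA.isHalfDuality hE rR, rR.isHalfDuality hE rA⟩

theorem hasInjCogen_of_finite (k : Type u) [CommRing k] [IsArtinianRing k] (A : Type u) [Ring A]
    [Algebra k A] [Module.Finite k A] : HasInjCogen A := by
  have : Module.Finite k Aᵐᵒᵖ := .equiv (MulOpposite.opLinearEquiv k)
  obtain ⟨I, _, _, _, _, _, h, h'⟩ := exists_duality k (A := A) (R := Aᵐᵒᵖ) .refl
  exact h.hasInjCogen h'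

theorem extDim_le_extDim_op (k : Type u) [CommRing k] [IsArtinianRing k] {A R : Type u} [Ring A]
    [Algebra k A] [Ring R] [Algebra k R] [Module.Finite k A] (φ : R ≃ₐ[k] Aᵐᵒᵖ) :
    extDim A ≤ extDim R := by
  have : Module.Finite k Aᵐᵒᵖ := .equiv (MulOpposite.opLinearEquiv k)
  have : Module.Finite k R := .equiv φ.symm.toLinearEquiv
  obtain ⟨I, _, _, _, _, _, h, h'⟩ := exists_duality k φ
  exact h.extDim_le h'

end Algebra

section Resolutions

variable {A : Type u} [Ring A] {T X Y Z : ModuleCat.{u} A} {f : X →ₗ[A] Y} {g : Y →ₗ[A] Z}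

theorem ProjRes.equiv : ∀ {j : ℕ} {X Y : ModuleCat.{u} A}, (X ≃ₗ[A] Y) → ProjRes A X j →
    ProjRes A Y j
  | 0, _, _, e, h => have : Module.Projective A _ := h; Module.Projective.of_equiv e
  | _ + 1, _, _, e, ⟨P, g, hP, hPf, hg, h⟩ =>
    ⟨P, e.toLinearMap ∘ₗ g, hP, hPf, e.surjective.comp hg,
      h.equiv (LinearEquiv.ofEq _ _ (LinearEquiv.ker_comp e g).symm)⟩

theorem ProjRes.of_ses {j : ℕ} (h : IsSES A f g) (hY : Module.Projective A Y)
    (hYf : Module.Finite A Y) (hX : ProjRes A X j) : ProjRes A Z (j + 1) :=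
  ⟨Y, g, hY, hYf, h.2.1, hX.equiv ((LinearEquiv.ofInjective f h.1).trans
    (LinearEquiv.ofEq _ _ h.2.2))⟩

theorem CoresBy.equiv : ∀ {j : ℕ} {X Y : ModuleCat.{u} A}, (X ≃ₗ[A] Y) → CoresBy A T X j →
    CoresBy A T Y j
  | 0, _, _, e, h => memAdd.retract h (.of_equiv e.symm)
  | _ + 1, _, _, e, ⟨T₀, i, hT₀, hi, h⟩ =>
    ⟨T₀, i ∘ₗ e.symm.toLinearMap, hT₀, hi.comp e.symm.injective,
      h.equiv (Submodule.quotEquivOfEq _ _ (LinearEquiv.range_comp e.symm i).symm)⟩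

theorem CoresBy.of_ses {j : ℕ} (h : IsSES A f g) (hY : Y ∈ addOf A T) (hZ : CoresBy A T Z j) :
    CoresBy A T X (j + 1) :=
  ⟨Y, f, hY, h.1, hZ.equiv ((Submodule.quotEquivOfEq _ _ h.2.2).trans
    (g.quotKerEquivOfSurjective h.2.1)).symm⟩

theorem projective_of_mem_addOf (hX : X ∈ addOf A (ModuleCat.of A A)) : Module.Projective A X := by
  obtain ⟨r, s, p, hsp⟩ := mem_addOf_iff.1 hX
  exact Module.Projective.of_split (M := Fin r → A) s p hsp

theorem mem_addOf_of_projective [Module.Finite A X] [Module.Projective A X] :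
    X ∈ addOf A (ModuleCat.of A A) := by
  obtain ⟨r, p, hp⟩ := Module.Finite.exists_fin' A X
  obtain ⟨s, hs⟩ := Module.projective_lifting_property p LinearMap.id hp
  exact mem_addOf_iff.2 ⟨r, s, p, hs⟩

end Resolutions

section EndSide

variable {A : Type u} [Ring A] {T : ModuleCat.{u} A}

/-- `Hom_A(T, T)` is the regular module over `End_A(T)`. -/
def dualSelf (T : ModuleCat.{u} A) :
    dual (Module.End A T) T T ≃ₗ[Module.End A T] Module.End A T where
  toFun h := h
  map_add' _ _ := rfl
  map_smul' _ _ := rfl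
  invFun h := h
  left_inv _ := rfl
  right_inv _ := rfl

/-- `T` as a module over its endomorphism ring. -/
abbrev endSide (T : ModuleCat.{u} A) : ModuleCat.{u} (Module.End A T) :=
  ModuleCat.of (Module.End A T) T

/-- `Hom_A(A, T)` is isomorphic to `T`. -/
def dualRing (T : ModuleCat.{u} A) :
    dual (Module.End A T) T (ModuleCat.of A A) ≃ₗ[Module.End A T] endSide T :=
  LinearMap.ringLmapEquivSelf A (Module.End A T) T

theorem dual_mem_addOf {X : ModuleCat.{u} A} (hX : X ∈ addOf A T) :
    dual (Module.End A T) T X ∈ addOf _ (ModuleCat.of _ (Module.End A T)) :=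
  addOf_mono (memAdd.retract (addOf_self _) (.of_equiv (dualSelf T))) (dual_addOf hX)

theorem evalDual_bijective_of_addOf {X : ModuleCat.{u} A} (hX : X ∈ addOf A T) :
    Function.Bijective (evalDual (Module.End A T) T X) := by
  obtain ⟨r, s, p, hsp⟩ := mem_addOf_iff.1 hX
  refine ⟨(injective_iff_map_eq_zero _).2 fun x hx ↦ ?_, fun ξ ↦ ?_⟩
  · have : s x = 0 := funext fun i ↦
      congr((show dual (Module.End A T) T X →ₗ[Module.End A T] T from $hx)
        (LinearMap.proj i ∘ₗ s))
    have h := congr($hsp x)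
    rw [LinearMap.comp_apply, this, map_zero] at h
    exact h.symm
  · let ξ' : dual (Module.End A T) T X →ₗ[Module.End A T] T := ξ
    let π (i : Fin r) : X →ₗ[A] T := LinearMap.proj i ∘ₗ s
    refine ⟨p fun i ↦ ξ' (π i), LinearMap.ext fun h ↦ ?_⟩
    let h' : X →ₗ[A] T := h
    let c (i : Fin r) : Module.End A T := (h' ∘ₗ p) ∘ₗ LinearMap.single A (fun _ ↦ T) i
    have hsum (w : Fin r → T) : h' (p w) = ∑ i, c i (w i) := by
      conv_lhs => rw [← Finset.univ_sum_single w]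
      simp only [map_sum]
      rfl
    have hh : h' = ∑ i, c i • π i := LinearMap.ext fun x ↦ by
      rw [LinearMap.sum_apply, ← show p (s x) = x from congr($hsp x), hsum]
      rw [show p (s x) = x from congr($hsp x)]
      rfl
    have h2 : ξ' h' = ∑ i, c i (ξ' (π i)) := by
      conv_lhs => rw [hh]
      rw [map_sum]
      exact Finset.sum_congr rfl fun i _ ↦ map_smul ξ' _ _
    exact (hsum _).trans h2.symm

variable [HasExt.{u} (ModuleCat.{u} A)] {n : ℕ}

theorem IsSES.dual_of_extZero {X Y Z : ModuleCat.{u} A} {f : X →ₗ[A] Y} {g : Y →ₗ[A] Z}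
    (h : IsSES A f g) (hZ : ExtZero Z T 1) :
    IsSES (Module.End A T) (dualMap (Module.End A T) T g) (dualMap (Module.End A T) T f) :=
  h.dual fun p ↦ h.extend_of_extZero hZ p

theorem IsTilting.projRes_dual (hT : IsTilting T n) :
    ∀ {j : ℕ} {V : ModuleCat.{u} A}, CoresBy A T V j →
      ProjRes (Module.End A T) (dual (Module.End A T) T V) j
  | 0, _, hV => projective_of_mem_addOf (dual_mem_addOf hV)
  | _ + 1, _, ⟨_, _, hT₀, hι, hV⟩ =>
    .of_ses ((isSES_of_injective hι).dual_of_extZero (LeftPerp.of_coresBy hV T hT.ext 1 one_pos))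
      (projective_of_mem_addOf (dual_mem_addOf hT₀))
      (finite_of_mem_addOf (T := ModuleCat.of _ (Module.End A T)) (dual_mem_addOf hT₀))
      (hT.projRes_dual hV)

theorem ProjRes.coresBy_dual [IsNoetherianRing A] :
    ∀ {j : ℕ} {X : ModuleCat.{u} A}, ProjRes A X j → Module.Finite A X →
      (∀ i, 0 < i → ExtZero X T i) →
      CoresBy (Module.End A T) (endSide T) (dual (Module.End A T) T X) j
  | 0, X, h, _, _ => by
    have : Module.Projective A X := h
    exact addOf_mono (memAdd.retract (addOf_self _) (.of_equiv (dualRing T)))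
      (dual_addOf mem_addOf_of_projective)
  | j + 1, X, ⟨P, g, hP, hPf, hg, h⟩, _, hX => by
    have hs := isSES_of_surjective hg
    exact .of_ses (hs.dual_of_extZero (hX 1 one_pos))
      (addOf_mono (memAdd.retract (addOf_self _) (.of_equiv (dualRing T)))
        (dual_addOf mem_addOf_of_projective))
      (h.coresBy_dual hs.finite_left fun i hi ↦
        hs.extZero_left_left (.of_projective hi) (hX (i + 1) i.succ_pos))

variable [HasExt.{u} (ModuleCat.{u} (Module.End A T))]

theorem IsTilting.extZero_dual (hT : IsTilting T n) :
    ∀ {j : ℕ} {V : ModuleCat.{u} A}, CoresBy A T V j →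
      Function.Bijective (evalDual (Module.End A T) T V) ∧
        ∀ i, 0 < i → ExtZero (dual (Module.End A T) T V) (endSide T) i
  | 0, V, hV => by
    have := projective_of_mem_addOf (dual_mem_addOf hV)
    exact ⟨evalDual_bijective_of_addOf hV, fun i hi ↦ .of_projective hi⟩
  | j + 1, V, ⟨T₀, ι, hT₀, hι, hV⟩ => by
    have hs := isSES_of_injective hι
    have hd := hs.dual_of_extZero (LeftPerp.of_coresBy hV T hT.ext 1 one_pos)
    have := projective_of_mem_addOf (dual_mem_addOf hT₀)
    have h₀ := evalDual_bijective_of_addOf hT₀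
    obtain ⟨h₁, h₂⟩ := hT.extZero_dual hV
    refine ⟨⟨(injective_iff_map_eq_zero _).2 fun x hx ↦ ?_, fun ξ ↦ ?_⟩, ?_⟩
    · refine hι ((h₀.1 ?_).trans (map_zero ι).symm)
      rw [map_zero]
      exact LinearMap.ext fun h ↦
        congr((show dual (Module.End A T) T V →ₗ[Module.End A T] T from $hx)
          (dualMap (Module.End A T) T ι h))
    · let ξ' : dual (Module.End A T) T V →ₗ[Module.End A T] T := ξ
      obtain ⟨t, ht⟩ := h₀.2 (ξ' ∘ₗ dualMap (Module.End A T) T ι)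
      have ht' (h : T₀ →ₗ[A] T) : h t = ξ' (dualMap (Module.End A T) T ι h) :=
        congr((show dual (Module.End A T) T T₀ →ₗ[Module.End A T] T from $ht) h)
      obtain ⟨v, rfl⟩ : ∃ v, ι v = t := by
        refine hs.exists_preimage (h₁.1 ?_)
        rw [map_zero]
        refine LinearMap.ext fun h ↦ ?_
        refine (ht' (dualMap (Module.End A T) T (Submodule.mkQ _) h)).trans ?_
        rw [hd.comp_apply, map_zero]
        rfl
      refine ⟨v, LinearMap.ext fun h ↦ ?_⟩
      obtain ⟨h, rfl⟩ := hd.2.1 h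
      exact ht' h
    · rintro (_ | _ | i) hi
      · omega
      · refine hd.extZero_one_of_extend (.of_projective one_pos) fun p ↦ ?_
        obtain ⟨v, hv⟩ := h₁.2 p
        obtain ⟨t, rfl⟩ := hs.2.1 v
        exact ⟨evalDual (Module.End A T) T T₀ t, fun h ↦
          congr((show dual (Module.End A T) T _ →ₗ[Module.End A T] T from $hv) h)⟩
      · exact hd.extZero_left_right (h₂ (i + 1) i.succ_pos) (.of_projective (by omega))

theorem IsTilting.endSide [IsNoetherianRing A] [Module.Finite A T] (hT : IsTilting T n) :
    IsTilting (endSide T) n where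
  projRes := (hT.projRes_dual hT.cores).equiv (dualRing T)
  ext i hi := ((hT.extZero_dual hT.cores).2 i hi).retract_left (.of_equiv (dualRing T).symm)
  cores := (hT.projRes.coresBy_dual inferInstance hT.ext).equiv (dualSelf T)

theorem IsTilting.bijective_lsmul (hT : IsTilting T n) (k : Type u) [CommRing k] [Algebra k A]
    [Module k T] [IsScalarTower k A T] :
    Function.Bijective (Algebra.lsmul k (Module.End A T) T : A →ₐ[k] _) := by
  have h := (hT.extZero_dual hT.cores).1
  have key (a : A) (t : T) : (show dual (Module.End A T) T (ModuleCat.of A A)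
      →ₗ[Module.End A T] T from evalDual (Module.End A T) T (ModuleCat.of A A) a)
        ((dualRing T).symm t) = a • t := rfl
  refine ⟨(injective_iff_map_eq_zero _).2 fun a ha ↦
    (injective_iff_map_eq_zero _).1 h.1 a (LinearMap.ext fun p ↦ ?_), fun ξ ↦ ?_⟩
  · obtain ⟨t, rfl⟩ := (dualRing T).symm.surjective p
    exact (key a t).trans congr($ha t)
  · obtain ⟨a, ha⟩ := h.2 (ξ ∘ₗ (dualRing T).toLinearMap)
    refine ⟨a, LinearMap.ext fun t ↦ (key a t).symm.trans ?_⟩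
    refine congr((show dual (Module.End A T) T (ModuleCat.of A A) →ₗ[Module.End A T] T from $ha)
      ((dualRing T).symm t)).trans ?_
    exact congrArg ξ ((dualRing T).apply_symm_apply t)

end EndSide

section Main

theorem finite_hom (k : Type u) [CommRing k] [IsNoetherianRing k] {A : Type u} [Ring A]
    [Algebra k A] (X Y : Type u) [AddCommGroup X] [Module A X] [Module k X] [IsScalarTower k A X]
    [AddCommGroup Y] [Module A Y] [Module k Y] [IsScalarTower k A Y] [Module.Finite k X]
    [Module.Finite k Y] : Module.Finite k (X →ₗ[A] Y) :=
  Module.Finite.of_injective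
    ({ toFun := fun f ↦ f.restrictScalars k
       map_add' := fun _ _ ↦ rfl
       map_smul' := fun _ _ ↦ rfl } : (X →ₗ[A] Y) →ₗ[k] (X →ₗ[k] Y))
    (LinearMap.restrictScalars_injective k)

theorem IsTilting.extDim_end_op_le (k : Type u) [CommRing k] [IsArtinianRing k] {A : Type u}
    [Ring A] [Algebra k A] [Module.Finite k A] [HasExt.{u} (ModuleCat.{u} A)]
    {T : ModuleCat.{u} A} [Module k T] [IsScalarTower k A T] [Module.Finite A T] {n : ℕ}
    (hT : IsTilting T n) : extDim (Module.End A T)ᵐᵒᵖ ≤ extDim A + n := by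
  have : Module.Finite k T := .trans A T
  have : Module.Finite k (Module.End A T) := finite_hom k T T
  have : Module.Finite k (Module.End A T)ᵐᵒᵖ := .equiv (MulOpposite.opLinearEquiv k)
  have : IsNoetherianRing A := .of_finite k A
  have : IsNoetherianRing (Module.End A T)ᵐᵒᵖ := .of_finite k _
  refine hT.extDim_le (hasInjCogen_of_finite k A) (hasInjCogen_of_finite k _) fun X hX ↦ ?_
  let _ : Module k X := Module.compHom X (algebraMap k A)
  have : IsScalarTower k A X := ⟨fun c a x ↦ by rw [Algebra.smul_def, mul_smul]; rfl⟩
  have : Module.Finite k X := .trans A X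
  have : Module.Finite k (T →ₗ[A] X) := finite_hom k T X
  have : IsScalarTower k (Module.End A T)ᵐᵒᵖ (T →ₗ[A] X) :=
    ⟨fun c φ h ↦ LinearMap.ext fun t ↦ by
      change h (c • φ.unop t) = c • h (φ.unop t)
      exact map_smul (h.restrictScalars k) _ _⟩
  exact Module.Finite.of_restrictScalars_finite k _ _

end Main

end Paper

open Paper in
/-- If `T` is a tilting `A`-module of projective dimension `n` and
`B = End_A(T)`, then `|ed(A) − ed(B)| ≤ n`. -/
theorem stmt7 (k : Type u) [CommRing k] [IsArtinianRing k]
    (A : Type u) [Ring A] [Algebra k A] [Module.Finite k A]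
    [CategoryTheory.HasExt.{u} (ModuleCat.{u} A)]
    (T : ModuleCat.{u} A) (hT : Module.Finite A T)
    (n : ℕ) (hpd : ProjRes A T n)
    (hext : ∀ i : ℕ, 0 < i → Subsingleton (CategoryTheory.Abelian.Ext T T i))
    (hcores : CoresBy A T (ModuleCat.of A A) n) :
    extDim A ≤ extDim (Module.End A T) + (n : ℕ∞) ∧
      extDim (Module.End A T) ≤ extDim A + (n : ℕ∞) := by
  let _ : Module k T := Module.compHom T (algebraMap k A)
  have : IsScalarTower k A T := ⟨fun c a x ↦ by rw [Algebra.smul_def, mul_smul]; rfl⟩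
  have : Module.Finite k T := .trans A T
  have : Module.Finite k (Module.End A T) := finite_hom k T T
  have : IsNoetherianRing A := .of_finite k A
  have : HasExt.{u} (ModuleCat.{u} (Module.End A T)) := hasExt_of_enoughProjectives _
  have hA : IsTilting T n := ⟨hpd, hext, hcores⟩
  have hfin : Module.Finite (Module.End A T) T := .of_restrictScalars_finite k _ _
  refine ⟨(extDim_le_extDim_op k (AlgEquiv.op
    (AlgEquiv.ofBijective _ (hA.bijective_lsmul k)).symm)).trans ?_,
    (extDim_le_extDim_op k .refl).trans (hA.extDim_end_op_le k)⟩
  exact IsTilting.extDim_end_op_le k (T := endSide T) hA.endSide
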